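/- arXiv:math/0407030 — 2 statements merged into one kernel-verified Lean document; each statement's English description precedes it below -/
import Mathlib

section
/- Let k be an algebraically closed field of characteristic 0, and let p_1,…,p_n ∈ k[x_1,…,x_n] be homogeneous polynomials whose common zero set in k^n is exactly {0}. Let M = deg p_1 + ⋯ + deg p_n and N = M − n + 1. Then there exist polynomials q_{i,α} ∈ k[x_1,…,x_n], for i = 1,…,n and multi-indices α with |α| = N, such that for every polynomial f ∈ k[x_1,…,x_n]: θ(θ−1)⋯(θ−(M−n)) f = Σ_{|α| = N} Σ_{i=1}^n (N!/α!) · x^α · q_{i,α}(∂)( p_i(∂) f ), where the left-hand side is the composition of the operators f ↦ θf − j·f for j = 0, 1, …, M−n. (This exhibits b(T) = T(T−1)⋯(T−(M−n)) as a monodromic b-function along {0} for the system p_1(∂)u = ⋯ = p_n(∂)u = 0.) -/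
open MvPolynomial

/-- The iterated partial derivative `∂^α = ∂_1^{α_1} ⋯ ∂_n^{α_n}` on
`k[x_1,…,x_n]`. -/
noncomputable def partialDerivPow {k : Type*} [CommRing k] {n : ℕ} (α : Fin n → ℕ)
    (f : MvPolynomial (Fin n) k) : MvPolynomial (Fin n) k :=
  (List.finRange n).foldl (fun g i => (fun h => pderiv i h)^[α i] g) f

/-- The constant-coefficient differential operator `p(∂)` attached to a
polynomial `p = Σ c_α x^α`, namely `f ↦ Σ c_α ∂^α f`. -/
noncomputable def diffOp {k : Type*} [CommRing k] {n : ℕ}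
    (p f : MvPolynomial (Fin n) k) : MvPolynomial (Fin n) k :=
  ∑ e ∈ p.support, C (p.coeff e) * partialDerivPow (fun i => e i) f

/-- The Euler operator `θ(f) = Σ_i x_i · ∂_i f` on `k[x_1,…,x_n]`. -/
noncomputable def eulerOp {k : Type*} [CommRing k] {n : ℕ}
    (f : MvPolynomial (Fin n) k) : MvPolynomial (Fin n) k :=
  ∑ i, X i * pderiv i f

/-- The operator `θ(θ-1)(θ-2)⋯(θ-N+1)`, i.e. the composition of the operators
`f ↦ θf - j·f` for `j = 0, 1, …, N-1`. -/
noncomputable def eulerFactorial {k : Type*} [CommRing k] {n : ℕ} :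
    ℕ → MvPolynomial (Fin n) k → MvPolynomial (Fin n) k
  | 0 => id
  | (N + 1) => fun f => eulerFactorial N (eulerOp f - (N : MvPolynomial (Fin n) k) * f)

namespace BFun

variable {k : Type*} [Field k] {n : ℕ}

section comp
attribute [local instance] MvPolynomial.gradedAlgebra

lemma comp_mul (c q : MvPolynomial (Fin n) k) (d e : ℕ) (hq : q.IsHomogeneous d) :
    homogeneousComponent e (c * q) =
      if d ≤ e then homogeneousComponent (e - d) c * q else 0 := by
  have h := DirectSum.coe_decompose_mul_of_right_mem (homogeneousSubmodule (Fin n) k) (a := c) e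
    ((mem_homogeneousSubmodule d q).2 hq)
  have hd : ∀ (φ : MvPolynomial (Fin n) k) (i : ℕ),
      (DirectSum.decompose (homogeneousSubmodule (Fin n) k) φ i : MvPolynomial (Fin n) k)
        = homogeneousComponent i φ := fun φ i => decomposition.decompose'_apply φ i
  rw [← hd, ← hd]
  exact h

end comp

/-- Closed under homogeneous components. -/
def HomI (J : Ideal (MvPolynomial (Fin n) k)) : Prop :=
  ∀ p ∈ J, ∀ e, homogeneousComponent e p ∈ J

/-- Nonzerodivisor modulo an ideal. -/
def Nzd (J : Ideal (MvPolynomial (Fin n) k)) (a : MvPolynomial (Fin n) k) : Prop :=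
  ∀ m, a * m ∈ J → m ∈ J

/-- Regular sequence modulo an ideal (no properness). -/
def Reg : Ideal (MvPolynomial (Fin n) k) → List (MvPolynomial (Fin n) k) → Prop
  | _, [] => True
  | J, a :: t => Nzd J a ∧ Reg (J ⊔ Ideal.span {a}) t

lemma homI_bot : HomI (⊥ : Ideal (MvPolynomial (Fin n) k)) := by
  intro p hp e
  rw [Ideal.mem_bot] at hp
  subst hp
  simp

lemma mem_sup {J : Ideal (MvPolynomial (Fin n) k)} {q h : MvPolynomial (Fin n) k} :
    h ∈ J ⊔ Ideal.span {q} ↔ ∃ a ∈ J, ∃ c, h = a + c * q := by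
  rw [Submodule.mem_sup]
  constructor
  · rintro ⟨a, ha, b, hb, rfl⟩
    obtain ⟨c, rfl⟩ := Ideal.mem_span_singleton'.1 hb
    exact ⟨a, ha, c, rfl⟩
  · rintro ⟨a, ha, c, rfl⟩
    exact ⟨a, ha, c * q, Ideal.mem_span_singleton'.2 ⟨c, rfl⟩, rfl⟩

lemma homI_sup {J : Ideal (MvPolynomial (Fin n) k)} (hJ : HomI J) {q : MvPolynomial (Fin n) k}
    {d : ℕ} (hq : q.IsHomogeneous d) : HomI (J ⊔ Ideal.span {q}) := by
  intro p hp e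
  obtain ⟨a, ha, c, rfl⟩ := mem_sup.1 hp
  rw [map_add, comp_mul c q d e hq]
  split_ifs
  · exact mem_sup.2 ⟨_, hJ a ha e, _, rfl⟩
  · exact mem_sup.2 ⟨_, hJ a ha e, 0, by simp⟩

lemma homI_ofList (t : List (MvPolynomial (Fin n) k)) (ht : ∀ x ∈ t, ∃ d, x.IsHomogeneous d) :
    HomI (Ideal.ofList t) := by
  induction t with
  | nil => simpa using homI_bot
  | cons a t ih =>
    rw [Ideal.ofList_cons, sup_comm]
    obtain ⟨d, hd⟩ := ht a (by simp)
    exact homI_sup (ih fun x hx => ht x (by simp [hx])) hd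

/-- decomposition of a homogeneous element -/
lemma decomp {J : Ideal (MvPolynomial (Fin n) k)} (hJ : HomI J) {q h : MvPolynomial (Fin n) k}
    {d e : ℕ} (hq : q.IsHomogeneous d) (hh : h.IsHomogeneous e) (hm : h ∈ J ⊔ Ideal.span {q}) :
    ∃ a ∈ J, ∃ c, MvPolynomial.IsHomogeneous c (e - d) ∧ h = a + c * q := by
  obtain ⟨a, ha, c, rfl⟩ := mem_sup.1 hm
  have := homogeneousComponent_eq_self hh
  rw [map_add, comp_mul c q d e hq] at this
  refine ⟨_, hJ a ha e, if d ≤ e then homogeneousComponent (e - d) c else 0, ?_, ?_⟩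
  · split_ifs
    · exact homogeneousComponent_isHomogeneous _ _
    · exact isHomogeneous_zero _ _ _
  · rw [← this]; split_ifs <;> simp

lemma mem_of_forall_pow {J : Ideal (MvPolynomial (Fin n) k)} (hJ : HomI J)
    {m : MvPolynomial (Fin n) k} (h : ∀ r, m ∈ J ⊔ idealOfVars (Fin n) k ^ r) : m ∈ J := by
  obtain ⟨a, ha, b, hb, rfl⟩ := Submodule.mem_sup.1 (h (m.totalDegree + 1))
  set m := a + b with hm
  have key : ∀ e ∈ Finset.range (m.totalDegree + 1), homogeneousComponent e m ∈ J := by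
    intro e he
    rw [hm, map_add]
    have : homogeneousComponent e b = 0 := by
      ext x
      rw [coeff_homogeneousComponent]
      split_ifs with hx
      · rw [mem_pow_idealOfVars_iff'] at hb
        rw [hb x (by rw [hx]; exact Finset.mem_range.1 he)]; simp
      · simp
    rw [this, add_zero]
    exact hJ a ha e
  rw [← sum_homogeneousComponent m]
  exact Ideal.sum_mem _ key

lemma nzd_swap1 {J : Ideal (MvPolynomial (Fin n) k)} (hJ : HomI J) {y z : MvPolynomial (Fin n) k}
    (hy0 : y ∈ idealOfVars (Fin n) k) (hy : Nzd J y) (hz : Nzd (J ⊔ Ideal.span {y}) z) :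
    Nzd J z := by
  have key : ∀ r, ∀ m, z * m ∈ J → m ∈ J ⊔ idealOfVars (Fin n) k ^ r := by
    intro r
    induction r with
    | zero => intro m _; simp
    | succ r ih =>
      intro m hm
      obtain ⟨a, ha, c, rfl⟩ := mem_sup.1 (hz m (Ideal.mem_sup_left hm))
      have h1 : z * c ∈ J := by
        apply hy
        have : y * (z * c) = z * (a + c * y) - z * a := by ring
        rw [this]
        exact J.sub_mem hm (J.mul_mem_left _ ha)
      obtain ⟨b, hb, s, hs, rfl⟩ := Submodule.mem_sup.1 (ih c h1)
      have : a + (b + s) * y = (a + y * b) + s * y := by ring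
      rw [this]
      refine Submodule.add_mem_sup (J.add_mem ha (J.mul_mem_left _ hb)) ?_
      rw [pow_succ]
      exact Ideal.mul_mem_mul hs hy0
  exact fun m hm => mem_of_forall_pow hJ fun r => key r m hm

lemma nzd_swap2 {J : Ideal (MvPolynomial (Fin n) k)} {y z : MvPolynomial (Fin n) k}
    (hy : Nzd J y) (hz : Nzd (J ⊔ Ideal.span {y}) z) : Nzd (J ⊔ Ideal.span {z}) y := by
  intro m hm
  obtain ⟨a, ha, c, hc⟩ := mem_sup.1 hm
  have h1 : z * c ∈ J ⊔ Ideal.span {y} :=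
    mem_sup.2 ⟨-a, J.neg_mem ha, m, by linear_combination -hc⟩
  obtain ⟨b, hb, s, rfl⟩ := mem_sup.1 (hz _ h1)
  have h2 : m - s * z ∈ J := by
    apply hy
    have : y * (m - s * z) = a + b * z := by linear_combination hc
    rw [this]
    exact J.add_mem ha (J.mul_mem_right _ hb)
  exact mem_sup.2 ⟨_, h2, s, by ring⟩

lemma Reg.perm {t t' : List (MvPolynomial (Fin n) k)} (h : t.Perm t')
    (ht : ∀ x ∈ t, x ∈ idealOfVars (Fin n) k ∧ ∃ d, x.IsHomogeneous d) :
    ∀ {J : Ideal (MvPolynomial (Fin n) k)}, HomI J → Reg J t → Reg J t' := by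
  induction h with
  | nil => intros; trivial
  | cons a h ih =>
    intro J hJ hr
    obtain ⟨d, hd⟩ := (ht a (by simp)).2
    exact ⟨hr.1, ih (fun x hx => ht x (by simp [hx])) (homI_sup hJ hd) hr.2⟩
  | swap z y t =>
    intro J hJ hr
    obtain ⟨h1, h2, h3⟩ := hr
    refine ⟨nzd_swap1 hJ (ht y (by simp)).1 h1 h2, nzd_swap2 h1 h2, ?_⟩
    rwa [sup_assoc, sup_comm (Ideal.span {z}), ← sup_assoc]
  | trans h1 h2 ih1 ih2 =>
    intro J hJ hr
    exact ih2 (fun x hx => ht x (h1.mem_iff.2 hx)) hJ (ih1 ht hJ hr)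

lemma Reg.append {t : List (MvPolynomial (Fin n) k)} {a : MvPolynomial (Fin n) k} :
    ∀ {J : Ideal (MvPolynomial (Fin n) k)},
      Reg J (t ++ [a]) ↔ Reg J t ∧ Nzd (J ⊔ Ideal.ofList t) a := by
  induction t with
  | nil => intro J; simp [Reg]
  | cons b t ih =>
    intro J
    simp only [List.cons_append, Reg, ih, Ideal.ofList_cons, and_assoc, sup_assoc]

lemma Nzd.pow {J : Ideal (MvPolynomial (Fin n) k)} {a : MvPolynomial (Fin n) k} (h : Nzd J a)
    (r : ℕ) : Nzd J (a ^ r) := by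
  induction r with
  | zero => intro m hm; simpa using hm
  | succ r ih => intro m hm; rw [pow_succ, mul_assoc] at hm; exact h _ (ih _ hm)

/-- zero set is exactly the origin -/
def Z (t : List (MvPolynomial (Fin n) k)) : Prop :=
  ∀ ξ : Fin n → k, (∀ x ∈ t, eval ξ x = 0) ↔ ξ = 0

lemma Z.perm {t t' : List (MvPolynomial (Fin n) k)} (h : t.Perm t') (hz : Z t) : Z t' := by
  intro ξ
  rw [← hz ξ]
  simp [h.mem_iff]

lemma Z.mem {t : List (MvPolynomial (Fin n) k)} (hz : Z t) {x} (hx : x ∈ t) :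
    x ∈ idealOfVars (Fin n) k := by
  have h := (hz 0).2 rfl x hx
  rw [← pow_one (idealOfVars (Fin n) k), mem_pow_idealOfVars_iff']
  intro e he
  have : e = 0 := by
    rw [← Finsupp.degree_eq_zero_iff]
    omega
  subst this
  simpa [constantCoeff_eq] using h

lemma exists_pow_le [IsAlgClosed k] {t : List (MvPolynomial (Fin n) k)} (hz : Z t) :
    ∃ L, idealOfVars (Fin n) k ^ L ≤ Ideal.ofList t := by
  apply Ideal.exists_pow_le_of_le_radical_of_fg _ (idealOfVars_fg _ _)
  rw [← vanishingIdeal_zeroLocus_eq_radical (K := k), Ideal.span_le]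
  rintro _ ⟨i, rfl⟩
  intro ξ hξ
  have : ξ = 0 := by
    rw [← hz ξ]
    intro x hx
    exact hξ x (Ideal.subset_span hx)
  simp [this]

lemma homog_mem_pow {h : MvPolynomial (Fin n) k} {e L : ℕ} (hh : h.IsHomogeneous e) (hL : L ≤ e) :
    h ∈ idealOfVars (Fin n) k ^ L := by
  rw [mem_pow_idealOfVars_iff']
  intro x hx
  exact hh.coeff_eq_zero (by omega)

/-- all forms of degree at least N are in J -/
def Big (N : ℕ) (J : Ideal (MvPolynomial (Fin n) k)) : Prop :=
  ∀ e, N ≤ e → ∀ h : MvPolynomial (Fin n) k, h.IsHomogeneous e → h ∈ J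

lemma big_pow {N : ℕ} {J : Ideal (MvPolynomial (Fin n) k)} (hJ : HomI J)
    {l : MvPolynomial (Fin n) k} (hl : l.IsHomogeneous 1) (hb : Big N (J ⊔ Ideal.span {l}))
    (K : ℕ) : Big (N + K - 1) (J ⊔ Ideal.span {l ^ K}) := by
  induction K with
  | zero => intro e _ h _; simp
  | succ K ih =>
    intro e he h hh
    obtain ⟨a, ha, c, hc, rfl⟩ := decomp hJ hl hh (hb e (by omega) h hh)
    obtain ⟨b, hb, s, rfl⟩ := mem_sup.1 (ih (e - 1) (by omega) c hc)
    exact mem_sup.2 ⟨a + b * l, J.add_mem ha (J.mul_mem_right _ hb), s, by ring⟩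

lemma eq_zero_of_deg_zero {p : MvPolynomial (Fin n) k} (hp : p.IsHomogeneous 0)
    (hm : p ∈ idealOfVars (Fin n) k) : p = 0 := by
  have := homogeneousComponent_eq_self hp
  rw [homogeneousComponent_zero] at this
  rw [← pow_one (idealOfVars (Fin n) k), mem_pow_idealOfVars_iff'] at hm
  rw [← this, hm 0 (by simp)]; simp

lemma exchange [IsAlgClosed k] {t : List (MvPolynomial (Fin n) k)} {l p : MvPolynomial (Fin n) k}
    {d N : ℕ} (ht : ∀ x ∈ t, ∃ d, x.IsHomogeneous d)
    (hl : l.IsHomogeneous 1) (hp : p.IsHomogeneous d)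
    (hzl : Z (l :: t)) (hz : Z (p :: t)) (hr : Reg ⊥ (l :: t))
    (hb : Big N (Ideal.ofList (l :: t))) :
    Reg ⊥ (p :: t) ∧ Big (N + (d - 1)) (Ideal.ofList (p :: t)) ∧ 1 ≤ d := by
  have hJ := homI_ofList t ht
  set J := Ideal.ofList t with hJdef
  have hr' : Reg ⊥ (t ++ [l]) := by
    refine hr.perm (List.perm_append_singleton l t).symm ?_ homI_bot
    intro x hx
    refine ⟨hzl.mem hx, ?_⟩
    rcases List.mem_cons.1 hx with rfl | hx
    · exact ⟨1, hl⟩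
    · exact ht x hx
  rw [Reg.append, bot_sup_eq] at hr'
  obtain ⟨hrt, hnl⟩ := hr'
  have hJm : J ≤ idealOfVars (Fin n) k := by
    rw [hJdef, Ideal.ofList, Ideal.span_le]
    intro x hx
    exact hz.mem (List.mem_cons_of_mem _ hx)
  have hone : (1 : MvPolynomial (Fin n) k) ∉ J := by
    intro h
    have := hJm h
    rw [← pow_one (idealOfVars (Fin n) k), mem_pow_idealOfVars_iff'] at this
    simpa using this 0 (by simp)
  obtain ⟨L, hL⟩ := exists_pow_le hz
  rw [Ideal.ofList_cons, sup_comm] at hL hb ⊢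
  have hlL : (l ^ (L + d)).IsHomogeneous (L + d) := by simpa using hl.pow (L + d)
  obtain ⟨a, ha, u, hu, hau⟩ := decomp hJ hp hlL (hL (homog_mem_pow hlL (by omega)))
  have hnlL := hnl.pow (L + d)
  have hp0 : p ≠ 0 := by
    rintro rfl
    rw [mul_zero, add_zero] at hau
    exact hone (hnlL 1 (by rw [hau, mul_one]; exact ha))
  have hd : 1 ≤ d := by
    by_contra h
    obtain rfl : d = 0 := by omega
    exact hp0 (eq_zero_of_deg_zero hp (hz.mem (by simp)))
  have hnu : Nzd J u := by
    intro m hm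
    apply hnlL
    rw [hau, show (a + u * p) * m = a * m + p * (u * m) by ring]
    exact J.add_mem (J.mul_mem_right _ ha) (J.mul_mem_left _ hm)
  have hnp : Nzd J p := by
    intro m hm
    apply hnlL
    rw [hau, show (a + u * p) * m = a * m + u * (p * m) by ring]
    exact J.add_mem (J.mul_mem_right _ ha) (J.mul_mem_left _ hm)
  refine ⟨?_, ?_, hd⟩
  · have : Reg ⊥ (t ++ [p]) := by
      rw [Reg.append, bot_sup_eq]; exact ⟨hrt, hnp⟩
    refine this.perm (List.perm_append_singleton p t) ?_ homI_bot
    intro x hx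
    have hx' : x ∈ p :: t := by simpa [or_comm] using hx
    refine ⟨hz.mem hx', ?_⟩
    rcases List.mem_cons.1 hx' with rfl | hx
    · exact ⟨d, hp⟩
    · exact ht x hx
  · intro e he g hg
    have h1 := big_pow hJ hl hb (L + d) (e + L) (by omega) (u * g) (by
      have := hu.mul hg
      rwa [show L + d - d + e = e + L by omega] at this)
    obtain ⟨b, hb, c, hc⟩ := mem_sup.1 h1
    have : g - c * p ∈ J := by
      apply hnu
      rw [show u * (g - c * p) = b + c * a by linear_combination hc + c * hau]
      exact J.add_mem hb (J.mul_mem_left _ ha)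
    exact mem_sup.2 ⟨_, this, c, by ring⟩

lemma eval_smul' {p : MvPolynomial (Fin n) k} {d : ℕ} (hp : p.IsHomogeneous d) (s : k)
    (ξ : Fin n → k) : eval (s • ξ) p = s ^ d * eval ξ p := by
  rw [eval_eq', eval_eq', Finset.mul_sum]
  refine Finset.sum_congr rfl fun e he => ?_
  have : e.degree = d := by
    by_contra h
    exact (mem_support_iff.1 he) (hp.coeff_eq_zero h)
  simp only [Pi.smul_apply, smul_eq_mul, mul_pow, Finset.prod_mul_distrib, Finset.prod_pow_eq_pow_sum]
  rw [← this, Finsupp.degree_eq_sum]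
  ring

lemma finite_affine [IsAlgClosed k] {t : List (MvPolynomial (Fin n) k)} {p : MvPolynomial (Fin n) k}
    {d : ℕ} (hd : 1 ≤ d) (ht : ∀ x ∈ t, ∃ d, x.IsHomogeneous d) (hp : p.IsHomogeneous d)
    (hz : Z (p :: t)) :
    {ξ : Fin n → k | (∀ x ∈ t, eval ξ x = 0) ∧ eval ξ p = 1}.Finite := by
  set F := {ξ : Fin n → k | (∀ x ∈ t, eval ξ x = 0) ∧ eval ξ p = 1} with hF
  obtain ⟨L, hL⟩ := exists_pow_le hz
  rw [Ideal.ofList_cons, sup_comm] at hL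
  have hJ := homI_ofList t ht
  let φ : MvPolynomial (Fin n) k →ₐ[k] (F → k) := aeval (fun i ξ => ξ.1 i)
  have hφ : ∀ q ξ, φ q ξ = eval ξ.1 q := by
    intro q ξ
    have : (Pi.evalAlgHom k (fun _ : F => k) ξ).comp φ = aeval ξ.1 := by
      ext i; simp [φ]
    have h2 := DFunLike.congr_fun this q
    simpa [aeval_eq_eval] using h2
  let W : Submodule k (MvPolynomial (Fin n) k) :=
    ⨆ e ∈ Finset.range L, homogeneousSubmodule (Fin n) k e
  have hW : W.FG := Submodule.fg_biSup _ _ fun e _ => homogeneousSubmodule_fg _ _ e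
  have key : ∀ e, ∀ h : MvPolynomial (Fin n) k, h.IsHomogeneous e → φ h ∈ W.map φ.toLinearMap := by
    intro e
    induction e using Nat.strong_induction_on with
    | _ e ih =>
    intro h hh
    by_cases he : e < L
    · refine ⟨h, ?_, rfl⟩
      exact Submodule.mem_iSup_of_mem e (Submodule.mem_iSup_of_mem (Finset.mem_range.2 he) hh)
    · obtain ⟨a, ha, c, hc, rfl⟩ := decomp hJ hp hh (hL (homog_mem_pow hh (by omega)))
      have : φ (a + c * p) = φ c := by
        ext ξ
        rw [hφ, hφ]
        have ha0 : eval ξ.1 a = 0 := by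
          have : Ideal.ofList t ≤ RingHom.ker (eval ξ.1) := by
            rw [Ideal.ofList, Ideal.span_le]
            intro x hx
            exact ξ.2.1 x hx
          exact this ha
        simp [ha0, ξ.2.2]
      rw [this]
      rcases Nat.eq_zero_or_pos e with rfl | hpos
      · exfalso
        have : (1 : MvPolynomial (Fin n) k) ∈ idealOfVars (Fin n) k ^ L := by
          rw [show L = 0 by omega]; simp
        have h1 := hL this
        have h2 : Ideal.ofList t ⊔ Ideal.span {p} ≤ idealOfVars (Fin n) k := by
          rw [sup_comm, ← Ideal.ofList_cons, Ideal.ofList, Ideal.span_le]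
          intro x hx
          exact hz.mem hx
        have := h2 h1
        rw [← pow_one (idealOfVars (Fin n) k), mem_pow_idealOfVars_iff'] at this
        simpa using this 0 (by simp)
      · exact ih (e - d) (by omega) c hc
  have key2 : ∀ h, φ h ∈ W.map φ.toLinearMap := by
    intro h
    rw [← sum_homogeneousComponent h, map_sum]
    exact Submodule.sum_mem _ fun e _ => key e _ (homogeneousComponent_isHomogeneous e h)
  have hfg : (Subalgebra.toSubmodule φ.range).FG := by
    have : Subalgebra.toSubmodule φ.range = W.map φ.toLinearMap := by
      apply le_antisymm
      · rintro _ ⟨h, rfl⟩; exact key2 h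
      · rintro _ ⟨h, _, rfl⟩; exact ⟨h, rfl⟩
    rw [this]
    exact hW.map _
  have hint : ∀ i, ∃ s : Set k, s.Finite ∧ ∀ ξ ∈ F, ξ i ∈ s := by
    intro i
    obtain ⟨P, hP, hP2⟩ := IsIntegral.of_mem_of_fg φ.range hfg (φ (X i)) ⟨X i, rfl⟩
    refine ⟨{a | P.IsRoot a}, Polynomial.finite_setOfPred_isRoot hP.ne_zero, fun ξ hξ => ?_⟩
    have h1 : Polynomial.aeval (φ (X i)) P = 0 := hP2
    have h2 := congrArg (Pi.evalAlgHom k (fun _ : F => k) ⟨ξ, hξ⟩) h1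
    rw [← Polynomial.aeval_algHom_apply] at h2
    simpa [φ, Polynomial.aeval_def, Polynomial.IsRoot, Polynomial.eval₂_eq_eval_map] using h2
  choose s hs hs2 using hint
  exact (Set.Finite.pi' hs).subset fun ξ hξ i => hs2 i ξ hξ

lemma avoid [IsAlgClosed k] {t : List (MvPolynomial (Fin n) k)} {p : MvPolynomial (Fin n) k}
    {d : ℕ} (ht : ∀ x ∈ t, ∃ d, x.IsHomogeneous d) (hp : p.IsHomogeneous d)
    (hz : Z (p :: t)) : ∃ c : Fin n → k, Z ((∑ i, C (c i) * X i) :: t) := by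
  have hp0 : eval (0 : Fin n → k) p = 0 := (hz 0).2 rfl p (by simp)
  rcases Nat.eq_zero_or_pos d with rfl | hd
  · have : p = 0 := eq_zero_of_deg_zero hp (hz.mem (by simp))
    refine ⟨0, ?_⟩
    simpa [this] using hz
  · have hfin := finite_affine hd ht hp hz
    set F := {ξ : Fin n → k | (∀ x ∈ t, eval ξ x = 0) ∧ eval ξ p = 1} with hF
    have : Infinite k := IsAlgClosed.instInfinite
    obtain ⟨c, hc⟩ : ∃ c : Fin n → k, ∀ ξ ∈ F, ∑ i, c i * ξ i ≠ 0 := by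
      let Q : MvPolynomial (Fin n) k := ∏ ξ ∈ hfin.toFinset, ∑ i, C (ξ i) * X i
      have hQ : Q ≠ 0 := by
        rw [Finset.prod_ne_zero_iff]
        intro ξ hξ h
        have hξ' : ξ ∈ F := by simpa using hξ
        have : ξ = 0 := by
          ext i
          have := congrArg (eval (Pi.single i 1)) h
          simpa [Pi.single_apply] using this
        rw [this] at hξ'
        have := hξ'.2
        rw [hp0] at this
        exact zero_ne_one this
      by_contra! hcon
      apply hQ
      apply MvPolynomial.funext
      intro c
      obtain ⟨ξ, hξ, h0⟩ := hcon c
      rw [map_zero, map_prod]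
      refine Finset.prod_eq_zero (i := ξ) (by simpa using hξ) ?_
      rw [← h0]
      simp [mul_comm]
    refine ⟨c, fun ξ => ⟨fun h => ?_, ?_⟩⟩
    · have hl := h (∑ i, C (c i) * X i) (by simp)
      have htξ : ∀ x ∈ t, eval ξ x = 0 := fun x hx => h x (by simp [hx])
      by_contra hne
      have hpξ : eval ξ p ≠ 0 := by
        intro h0
        apply hne
        rw [← hz ξ]
        intro x hx
        rcases List.mem_cons.1 hx with rfl | hx
        · exact h0
        · exact htξ x hx
      obtain ⟨s, hs⟩ := IsAlgClosed.exists_pow_nat_eq (eval ξ p)⁻¹ hd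
      refine hc (s • ξ) ⟨fun x hx => ?_, ?_⟩ ?_
      · obtain ⟨e, he⟩ := ht x hx
        rw [eval_smul' he, htξ x hx, mul_zero]
      · rw [eval_smul' hp, hs, inv_mul_cancel₀ hpξ]
      · have hl' : ∑ i, c i * ξ i = 0 := by simpa using hl
        have : ∑ i, c i * (s • ξ) i = s * ∑ i, c i * ξ i := by
          rw [Finset.mul_sum]
          exact Finset.sum_congr rfl fun i _ => by simp; ring
        rw [this, hl', mul_zero]
    · rintro rfl x hx
      rcases List.mem_cons.1 hx with rfl | hx
      · simp
      · exact (hz 0).2 rfl x (by simp [hx])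

end BFun
namespace BFun
variable {k : Type*} [Field k] {n : ℕ}

lemma ofList_perm {t t' : List (MvPolynomial (Fin n) k)} (h : t.Perm t') :
    Ideal.ofList t = Ideal.ofList t' := by
  unfold Ideal.ofList
  congr 1
  ext x
  exact h.mem_iff

lemma main_ind [IsAlgClosed k] (P Q : MvPolynomial (Fin n) k → Prop)
    (hP : ∀ l, P l → l.IsHomogeneous 1) (hPQ : ∀ l, P l → Q l)
    (hQ : ∀ l, Q l → ∃ d, l.IsHomogeneous d)
    (hav : 0 < n → ∀ t p, (∀ x ∈ t, Q x) → Q p → Z (p :: t) → ∃ l, P l ∧ Z (l :: t))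
    (base : ∀ ls, (∀ l ∈ ls, P l) → ls.length = n → Z ls → Reg ⊥ ls ∧ Big 1 (Ideal.ofList ls))
    (ps : List (MvPolynomial (Fin n) k × ℕ)) : ∀ ls : List (MvPolynomial (Fin n) k),
      (∀ l ∈ ls, P l) → (∀ x ∈ ps, Q x.1 ∧ x.1.IsHomogeneous x.2) → ps.length + ls.length = n →
      Z (ps.map Prod.fst ++ ls) →
      Reg ⊥ (ps.map Prod.fst ++ ls) ∧
      Big ((ps.map fun x => x.2 - 1).sum + 1) (Ideal.ofList (ps.map Prod.fst ++ ls)) ∧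
      ∀ x ∈ ps, 1 ≤ x.2 := by
  induction ps with
  | nil =>
    intro ls h1 _ h3 h4
    obtain ⟨a, b⟩ := base ls h1 (by simpa using h3) (by simpa using h4)
    exact ⟨by simpa using a, by simpa using b, by simp⟩
  | cons p ps ih =>
    intro ls h1 h2 h3 h4
    simp only [List.map_cons, List.cons_append, List.length_cons, List.sum_cons] at h3 h4 ⊢
    have ht : ∀ x ∈ ps.map Prod.fst ++ ls, Q x := by
      intro x hx
      rcases List.mem_append.1 hx with hx | hx
      · obtain ⟨y, hy, rfl⟩ := List.mem_map.1 hx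
        exact (h2 y (by simp [hy])).1
      · exact hPQ _ (h1 x hx)
    obtain ⟨hpQ, hph⟩ := h2 p (by simp)
    obtain ⟨l, hlP, hlZ⟩ := hav (by omega) _ p.1 ht hpQ h4
    have hperm : (ps.map Prod.fst ++ l :: ls).Perm (l :: (ps.map Prod.fst ++ ls)) :=
      List.perm_middle
    obtain ⟨hr, hb, hd⟩ := ih (l :: ls)
      (by intro x hx; rcases List.mem_cons.1 hx with rfl | hx; exacts [hlP, h1 x hx])
      (fun x hx => h2 x (by simp [hx])) (by simp; omega) (hlZ.perm hperm.symm)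
    rw [ofList_perm hperm] at hb
    have hr' := hr.perm hperm (fun x hx => by
      refine ⟨hlZ.mem (hperm.mem_iff.1 hx), ?_⟩
      rcases List.mem_cons.1 (hperm.mem_iff.1 hx) with rfl | hx
      · exact ⟨1, hP _ hlP⟩
      · exact hQ _ (ht x hx)) homI_bot
    obtain ⟨r1, r2, r3⟩ := exchange (fun x hx => hQ _ (ht x hx)) (hP _ hlP) hph hlZ h4 hr' hb
    refine ⟨r1, ?_, ?_⟩
    · convert r2 using 1; omega
    · intro x hx
      rcases List.mem_cons.1 hx with rfl | hx
      exacts [r3, hd x hx]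

lemma nzd_X {s : Set (Fin n)} {i : Fin n} (hi : i ∉ s) :
    Nzd (Ideal.span ((X : Fin n → MvPolynomial (Fin n) k) '' s)) (X i) := by
  intro m hm
  rw [mem_ideal_span_X_image] at hm ⊢
  intro e he
  obtain ⟨j, hj, hne⟩ := hm (Finsupp.single i 1 + e) (by
    rw [mem_support_iff, coeff_X_mul]; exact mem_support_iff.1 he)
  refine ⟨j, hj, ?_⟩
  have : i ≠ j := fun h => hi (h ▸ hj)
  simpa [Finsupp.single_apply, this] using hne

lemma reg_X (is : List (Fin n)) : ∀ s : Set (Fin n), is.Nodup → (∀ i ∈ is, i ∉ s) →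
    Reg (Ideal.span ((X : Fin n → MvPolynomial (Fin n) k) '' s)) (is.map X) := by
  induction is with
  | nil => intros; trivial
  | cons i is ih =>
    intro s hn hs
    rw [List.nodup_cons] at hn
    refine ⟨nzd_X (hs i (by simp)), ?_⟩
    rw [← Ideal.span_union, ← Set.image_singleton, ← Set.image_union]
    refine ih _ hn.2 fun j hj => ?_
    rintro (h | h)
    · exact hs j (by simp [hj]) h
    · rw [Set.mem_singleton_iff] at h
      exact hn.1 (h ▸ hj)

lemma base_X (ls : List (MvPolynomial (Fin n) k)) (hP : ∀ l ∈ ls, ∃ i, l = X i)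
    (hlen : ls.length = n) (hz : Z ls) : Reg ⊥ ls ∧ Big 1 (Ideal.ofList ls) := by
  obtain ⟨is, rfl⟩ : ∃ is : List (Fin n), is.map X = ls := by
    have : ls ∈ Set.range (List.map (X : Fin n → MvPolynomial (Fin n) k)) := by
      rw [Set.range_list_map]
      intro l hl
      obtain ⟨i, rfl⟩ := hP l hl
      exact ⟨i, rfl⟩
    exact this
  have hall : ∀ i, i ∈ is := by
    intro i
    by_contra hi
    have : (Pi.single i 1 : Fin n → k) = 0 := by
      rw [← hz]
      intro x hx
      obtain ⟨j, hj, rfl⟩ := List.mem_map.1 hx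
      have : j ≠ i := fun h => hi (h ▸ hj)
      simp [this]
    have := congrFun this i
    simp at this
  have hnd : is.Nodup := by
    have h1 : List.Subperm (List.finRange n) is :=
      List.subperm_of_subset (List.nodup_finRange n) fun i _ => hall i
    have h2 : (List.finRange n).Perm is := h1.perm_of_length_le (by simpa using hlen.le)
    exact h2.nodup (List.nodup_finRange n)
  constructor
  · have := reg_X (k := k) is ∅ hnd (by simp)
    simpa using this
  · intro e he h hh
    have h1 := homog_mem_pow hh he
    rw [pow_one] at h1
    refine (Ideal.span_le.2 ?_ : idealOfVars (Fin n) k ≤ _) h1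
    rintro _ ⟨i, rfl⟩
    exact Ideal.subset_span (List.mem_map.2 ⟨i, hall i, rfl⟩)

/-- linear forms -/
def Lin (l : MvPolynomial (Fin n) k) : Prop := ∃ c : Fin n → k, l = ∑ i, C (c i) * X i

lemma Lin.hom {l : MvPolynomial (Fin n) k} (h : Lin l) : l.IsHomogeneous 1 := by
  obtain ⟨c, rfl⟩ := h
  exact IsHomogeneous.sum _ _ _ fun i _ => isHomogeneous_C_mul_X _ _

lemma Lin.eval {l : MvPolynomial (Fin n) k} (h : Lin l) (a b : k) (v w : Fin n → k) :
    MvPolynomial.eval (a • v - b • w) l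
      = a * MvPolynomial.eval v l - b * MvPolynomial.eval w l := by
  obtain ⟨c, rfl⟩ := h
  simp only [map_sum, map_mul, eval_C, eval_X, Finset.mul_sum, ← Finset.sum_sub_distrib]
  refine Finset.sum_congr rfl fun i _ => ?_
  simp
  ring

lemma lin_X (i : Fin n) : Lin (X i : MvPolynomial (Fin n) k) :=
  ⟨Pi.single i 1, by
    rw [Finset.sum_eq_single i]
    · simp
    · intro j _ hj; simp [hj]
    · simp⟩

lemma avoid_X (hn : 0 < n) (t : List (MvPolynomial (Fin n) k)) (p : MvPolynomial (Fin n) k)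
    (ht : ∀ x ∈ t, Lin x) (hp : Lin p) (hz : Z (p :: t)) :
    ∃ l : MvPolynomial (Fin n) k, (∃ i, l = X i) ∧ Z (l :: t) := by
  by_contra! hcon
  have h1 : ∀ i : Fin n, ∃ ξ : Fin n → k, ξ ≠ 0 ∧ ξ i = 0 ∧ ∀ x ∈ t, MvPolynomial.eval ξ x = 0 := by
    intro i
    have := hcon (X i) ⟨i, rfl⟩
    by_contra! hc
    apply this
    intro ξ
    constructor
    · intro h
      by_contra hne
      obtain ⟨x, hx, hx0⟩ := hc ξ hne (by simpa using h (X i) (by simp))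
      exact hx0 (h x (by simp [hx]))
    · rintro rfl x hx
      rcases List.mem_cons.1 hx with rfl | hx
      · simp
      · exact (hz 0).2 rfl x (by simp [hx])
  choose ξ h0 h2 h3 using h1
  have hpne : ∀ i, MvPolynomial.eval (ξ i) p ≠ 0 := by
    intro i h
    apply h0 i
    rw [← hz]
    intro x hx
    rcases List.mem_cons.1 hx with rfl | hx
    · exact h
    · exact h3 i x hx
  let i0 : Fin n := ⟨0, hn⟩
  apply h0 i0
  ext i
  have hw : MvPolynomial.eval (ξ i0) p • ξ i - MvPolynomial.eval (ξ i) p • ξ i0 = 0 := by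
    rw [← hz]
    intro x hx
    rcases List.mem_cons.1 hx with rfl | hx
    · rw [hp.eval]; ring
    · rw [(ht x hx).eval, h3 i x hx, h3 i0 x hx]; ring
  have := congrFun hw i
  simpa [h2 i, hpne i] using this

lemma macaulay [IsAlgClosed k] (p : Fin n → MvPolynomial (Fin n) k) (deg : Fin n → ℕ)
    (hp : ∀ i, (p i).IsHomogeneous (deg i))
    (hz : {ξ : Fin n → k | ∀ i, MvPolynomial.eval ξ (p i) = 0} = {0}) :
    Big ((∑ i, deg i) - n + 1) (Ideal.span (Set.range p)) := by
  have base2 : ∀ ls : List (MvPolynomial (Fin n) k), (∀ l ∈ ls, Lin l) → ls.length = n → Z ls →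
      Reg ⊥ ls ∧ Big 1 (Ideal.ofList ls) := by
    intro ls h1 h2 h3
    have hm : (ls.map fun x => (x, 1)).map Prod.fst ++ [] = ls := by simp [Function.comp_def]
    obtain ⟨a, b, -⟩ := main_ind (fun l => ∃ i, l = X i) Lin
      (by rintro _ ⟨i, rfl⟩; exact isHomogeneous_X _ _) (by rintro _ ⟨i, rfl⟩; exact lin_X i)
      (fun l hl => ⟨1, hl.hom⟩) avoid_X base_X (ls.map fun x => (x, 1)) [] (by simp)
      (by
        intro x hx
        obtain ⟨y, hy, rfl⟩ := List.mem_map.1 hx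
        exact ⟨h1 y hy, (h1 y hy).hom⟩) (by simpa using h2) (by rwa [hm])
    rw [hm] at a b
    refine ⟨a, ?_⟩
    convert b using 1
    simp [Function.comp_def]
  have hm : ((List.finRange n).map fun i => (p i, deg i)).map Prod.fst ++ []
      = (List.finRange n).map p := by simp [Function.comp_def]
  obtain ⟨-, b, c⟩ := main_ind Lin (fun l => ∃ d, l.IsHomogeneous d) (fun l hl => hl.hom)
    (fun l hl => ⟨1, hl.hom⟩) (fun l hl => hl)
    (by
      rintro - t q ht ⟨d, hq⟩ hz
      obtain ⟨c, hc⟩ := avoid ht hq hz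
      exact ⟨_, ⟨c, rfl⟩, hc⟩) base2 ((List.finRange n).map fun i => (p i, deg i)) [] (by simp)
    (by
      intro x hx
      obtain ⟨i, -, rfl⟩ := List.mem_map.1 hx
      exact ⟨⟨_, hp i⟩, hp i⟩) (by simp)
    (by
      rw [hm]
      intro ξ
      have := Set.ext_iff.1 hz ξ
      simpa using this)
  rw [hm] at b
  have hid : Ideal.ofList ((List.finRange n).map p) = Ideal.span (Set.range p) := by
    unfold Ideal.ofList
    congr 1
    ext x
    simp
  rw [hid] at b
  have hd : ∀ i, 1 ≤ deg i := fun i => c (p i, deg i) (List.mem_map.2 ⟨i, by simp, rfl⟩)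
  convert b using 2
  rw [List.map_map]
  have h1 : ∑ i, deg i = ∑ i, (deg i - 1) + n := by
    have : ∀ i, deg i = (deg i - 1) + 1 := fun i => by have := hd i; omega
    rw [Finset.sum_congr rfl fun i _ => this i, Finset.sum_add_distrib]
    simp
  rw [h1, Nat.add_sub_cancel, Fin.sum_univ_def]
  rfl

end BFun
namespace BFun

lemma sum_tuple_succ (n N : ℕ) (f : (Fin (n + 1) → ℕ) → ℕ) :
    ∑ α ∈ Finset.Nat.antidiagonalTuple (n + 1) N, f α =
      ∑ x ∈ Finset.HasAntidiagonal.antidiagonal N, ∑ β ∈ Finset.Nat.antidiagonalTuple n x.2,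
        f (Fin.cons x.1 β) := by
  rw [Finset.sum_sigma' (Finset.HasAntidiagonal.antidiagonal N) (fun x => Finset.Nat.antidiagonalTuple n x.2)]
  refine Finset.sum_bij' (fun α _ => ⟨(α 0, ∑ i : Fin n, α i.succ), fun i => α i.succ⟩)
    (fun x _ => Fin.cons x.1.1 x.2) ?_ ?_ ?_ ?_ ?_
  · intro α h
    rw [Finset.Nat.mem_antidiagonalTuple, Fin.sum_univ_succ] at h
    simp [Finset.Nat.mem_antidiagonalTuple, h]
  · rintro ⟨⟨a, b⟩, β⟩ h
    simp only [Finset.mem_sigma, Finset.mem_antidiagonal, Finset.Nat.mem_antidiagonalTuple] at h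
    rw [Finset.Nat.mem_antidiagonalTuple, Fin.sum_univ_succ]
    have h1 := Finset.HasAntidiagonal.mem_antidiagonal.1 h.1
    simpa [h.2] using h1
  · intro α _
    exact Fin.cons_self_tail α
  · rintro ⟨⟨a, b⟩, β⟩ h
    simp only [Finset.mem_sigma, Finset.mem_antidiagonal, Finset.Nat.mem_antidiagonalTuple] at h
    obtain ⟨-, rfl⟩ := h
    simp
  · intro α _
    congr 1
    exact (Fin.cons_self_tail α).symm

lemma vander (n : ℕ) : ∀ (N : ℕ) (m : Fin n → ℕ),
    ∑ α ∈ Finset.Nat.antidiagonalTuple n N, ∏ i, (m i).choose (α i) = (∑ i, m i).choose N := by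
  induction n with
  | zero => intro N m; cases N <;> simp
  | succ n ih =>
    intro N m
    rw [sum_tuple_succ, Fin.sum_univ_succ, Nat.add_choose_eq]
    refine Finset.sum_congr rfl fun x _ => ?_
    rw [← ih x.2 (fun i => m i.succ), Finset.mul_sum]
    refine Finset.sum_congr rfl fun β _ => ?_
    simp [Fin.prod_univ_succ]

lemma vander' (n N : ℕ) (m : Fin n → ℕ) :
    ∑ α ∈ Finset.Nat.antidiagonalTuple n N,
      Nat.multinomial Finset.univ α * ∏ i, (m i).descFactorial (α i)
      = (∑ i, m i).descFactorial N := by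
  rw [Nat.descFactorial_eq_factorial_mul_choose, ← vander n N m, Finset.mul_sum]
  refine Finset.sum_congr rfl fun α hα => ?_
  rw [Finset.Nat.mem_antidiagonalTuple] at hα
  rw [← hα, ← Nat.multinomial_spec]
  simp_rw [Nat.descFactorial_eq_factorial_mul_choose, Finset.prod_mul_distrib]
  ring

variable {k : Type*} [Field k] {n : ℕ}

lemma iter_pderiv (i : Fin n) (a : ℕ) (m : Fin n →₀ ℕ) (c : k) :
    (fun h => pderiv i h)^[a] (monomial m c) =
      monomial (m - Finsupp.single i a) (c * ((m i).descFactorial a : k)) := by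
  induction a with
  | zero => simp
  | succ a ih =>
    rw [Function.iterate_succ_apply', ih, pderiv_monomial, tsub_tsub, ← Finsupp.single_add,
      Nat.descFactorial_succ]
    congr 1
    simp
    ring

lemma fold_monomial (α : Fin n → ℕ) (l : List (Fin n)) : ∀ (m : Fin n →₀ ℕ) (c : k), l.Nodup →
    l.foldl (fun g i => (fun h => pderiv i h)^[α i] g) (monomial m c) =
      monomial (m - (l.map fun i => Finsupp.single i (α i)).sum)
        (c * (l.map fun i => ((m i).descFactorial (α i) : k)).prod) := by
  induction l with
  | nil => intro m c _; simp
  | cons i l ih =>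
    intro m c hn
    rw [List.nodup_cons] at hn
    rw [List.foldl_cons, iter_pderiv, ih _ _ hn.2, tsub_tsub, List.map_cons, List.map_cons,
      List.sum_cons, List.prod_cons, mul_assoc]
    congr 3
    congr 1
    refine List.map_congr_left fun j hj => ?_
    have : i ≠ j := fun h => hn.1 (h ▸ hj)
    simp [Finsupp.single_apply, this]

lemma pdp_monomial (e m : Fin n →₀ ℕ) (c : k) :
    partialDerivPow (fun i => e i) (monomial m c) =
      monomial (m - e) (c * ∏ i, ((m i).descFactorial (e i) : k)) := by
  unfold partialDerivPow
  rw [fold_monomial _ _ _ _ (List.nodup_finRange n), ← Fin.sum_univ_def, ← Fin.prod_univ_def,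
    Finsupp.univ_sum_single]

lemma pdp_lin (α : Fin n → ℕ) : ∃ T : MvPolynomial (Fin n) k →ₗ[k] MvPolynomial (Fin n) k,
    ∀ f, partialDerivPow α f = T f := by
  unfold partialDerivPow
  induction List.finRange n with
  | nil => exact ⟨LinearMap.id, fun f => rfl⟩
  | cons i l ih =>
    obtain ⟨T, hT⟩ := ih
    refine ⟨T ∘ₗ ((pderiv i : Derivation k _ _).toLinearMap ^ α i), fun f => ?_⟩
    rw [List.foldl_cons, hT, LinearMap.comp_apply, Module.End.pow_apply]
    rfl

lemma pdp_add (α : Fin n → ℕ) (f g : MvPolynomial (Fin n) k) :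
    partialDerivPow α (f + g) = partialDerivPow α f + partialDerivPow α g := by
  obtain ⟨T, hT⟩ := pdp_lin (k := k) α
  simp [hT]

lemma pdp_C_mul (α : Fin n → ℕ) (c : k) (f : MvPolynomial (Fin n) k) :
    partialDerivPow α (C c * f) = C c * partialDerivPow α f := by
  obtain ⟨T, hT⟩ := pdp_lin (k := k) α
  simp [hT, ← smul_eq_C_mul]

lemma pdp_zero (α : Fin n → ℕ) :
    partialDerivPow α (0 : MvPolynomial (Fin n) k) = 0 := by
  obtain ⟨T, hT⟩ := pdp_lin (k := k) α
  simp [hT]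

lemma pdp_comp (e e' : Fin n →₀ ℕ) (f : MvPolynomial (Fin n) k) :
    partialDerivPow (fun i => (e + e') i) f =
      partialDerivPow (fun i => e i) (partialDerivPow (fun i => e' i) f) := by
  induction f using MvPolynomial.induction_on' with
  | add f g hf hg => rw [pdp_add, pdp_add, pdp_add, hf, hg]
  | monomial m c =>
    rw [pdp_monomial, pdp_monomial, pdp_monomial, tsub_tsub, add_comm e' e, mul_assoc,
      ← Finset.prod_mul_distrib]
    congr 2
    refine Finset.prod_congr rfl fun i _ => ?_
    have := Nat.descFactorial_mul_descFactorial (n := m i) (k := e' i) (m := e i + e' i) (by omega)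
    rw [Nat.add_sub_cancel] at this
    simp only [Finsupp.add_apply, Finsupp.tsub_apply]
    rw [← this]
    push_cast
    ring

lemma diffOp_of_subset (p f : MvPolynomial (Fin n) k) (s : Finset (Fin n →₀ ℕ))
    (hs : p.support ⊆ s) :
    diffOp p f = ∑ e ∈ s, C (p.coeff e) * partialDerivPow (fun i => e i) f := by
  unfold diffOp
  refine Finset.sum_subset hs fun e _ he => ?_
  rw [notMem_support_iff.1 he]
  simp

lemma diffOp_add (p q f : MvPolynomial (Fin n) k) :
    diffOp (p + q) f = diffOp p f + diffOp q f := by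
  classical
  rw [diffOp_of_subset _ f (p.support ∪ q.support) support_add,
    diffOp_of_subset p f (p.support ∪ q.support) Finset.subset_union_left,
    diffOp_of_subset q f (p.support ∪ q.support) Finset.subset_union_right,
    ← Finset.sum_add_distrib]
  refine Finset.sum_congr rfl fun e _ => ?_
  simp [add_mul]

lemma diffOp_monomial (e : Fin n →₀ ℕ) (c : k) (f : MvPolynomial (Fin n) k) :
    diffOp (monomial e c) f = C c * partialDerivPow (fun i => e i) f := by
  rw [diffOp_of_subset _ f {e} support_monomial_subset]
  simp

lemma diffOp_sum {ι : Type*} (s : Finset ι) (g : ι → MvPolynomial (Fin n) k)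
    (f : MvPolynomial (Fin n) k) : diffOp (∑ i ∈ s, g i) f = ∑ i ∈ s, diffOp (g i) f := by
  classical
  induction s using Finset.induction_on with
  | empty => simp [diffOp]
  | insert a s ha ih => rw [Finset.sum_insert ha, Finset.sum_insert ha, diffOp_add, ih]

lemma diffOp_add_right (p f g : MvPolynomial (Fin n) k) :
    diffOp p (f + g) = diffOp p f + diffOp p g := by
  simp [diffOp, pdp_add, mul_add, Finset.sum_add_distrib]

lemma diffOp_mul (p q f : MvPolynomial (Fin n) k) :
    diffOp (p * q) f = diffOp p (diffOp q f) := by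
  induction p using MvPolynomial.induction_on' with
  | add p p' hp hp' => rw [add_mul, diffOp_add, diffOp_add, hp, hp']
  | monomial e c =>
    induction q using MvPolynomial.induction_on' with
    | add q q' hq hq' => rw [mul_add, diffOp_add, diffOp_add, diffOp_add_right, hq, hq']
    | monomial e' c' =>
      rw [monomial_mul, diffOp_monomial, diffOp_monomial, diffOp_monomial, pdp_comp, pdp_C_mul,
        C_mul, mul_assoc]

lemma euler_add (f g : MvPolynomial (Fin n) k) : eulerOp (f + g) = eulerOp f + eulerOp g := by
  simp [eulerOp, mul_add, Finset.sum_add_distrib]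

lemma euler_monomial (m : Fin n →₀ ℕ) (c : k) :
    eulerOp (monomial m c) = monomial m (c * ((∑ i, m i : ℕ) : k)) := by
  unfold eulerOp
  have : ∀ i, X i * pderiv i (monomial m c) = monomial m (c * (m i : k)) := by
    intro i
    rw [pderiv_monomial, X, monomial_mul, one_mul]
    by_cases h : m i = 0
    · simp [h]
    · congr 1
      rw [add_tsub_cancel_of_le]
      simpa [Nat.one_le_iff_ne_zero] using h
  simp_rw [this]
  rw [← map_sum, ← Finset.mul_sum]
  simp

lemma ef_add (N : ℕ) : ∀ f g : MvPolynomial (Fin n) k,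
    eulerFactorial N (f + g) = eulerFactorial N f + eulerFactorial N g := by
  induction N with
  | zero => intro f g; rfl
  | succ N ih =>
    intro f g
    simp only [eulerFactorial]
    rw [← ih, euler_add]
    congr 1
    ring

lemma ef_monomial (N : ℕ) (m : Fin n →₀ ℕ) : ∀ c : k,
    eulerFactorial N (monomial m c) = monomial m (c * ((∑ i, m i).descFactorial N : k)) := by
  induction N with
  | zero => intro c; simp [eulerFactorial]
  | succ N ih =>
    intro c
    have : eulerOp (monomial m c) - (N : MvPolynomial (Fin n) k) * monomial m c
        = monomial m (c * (((∑ i, m i : ℕ) : k) - N)) := by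
      rw [euler_monomial, ← map_natCast (C : k →+* MvPolynomial (Fin n) k), C_mul_monomial,
        ← map_sub]
      congr 1
      ring
    simp only [eulerFactorial]
    rw [this, ih, Nat.descFactorial_succ, mul_assoc]
    congr 2
    rcases le_or_gt N (∑ i, m i) with h | h
    · rw [Nat.cast_mul, Nat.cast_sub h]
    · rw [Nat.descFactorial_eq_zero_iff_lt.2 h]; simp

lemma ef_eq (N : ℕ) (f : MvPolynomial (Fin n) k) :
    eulerFactorial N f = ∑ α ∈ Finset.Nat.antidiagonalTuple n N,
      (Nat.multinomial Finset.univ α : MvPolynomial (Fin n) k) *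
        ((∏ j, X j ^ α j) * partialDerivPow α f) := by
  induction f using MvPolynomial.induction_on' with
  | add f g hf hg =>
    rw [ef_add, hf, hg, ← Finset.sum_add_distrib]
    exact Finset.sum_congr rfl fun α _ => by rw [pdp_add]; ring
  | monomial m c =>
    rw [ef_monomial, ← vander', Nat.cast_sum, Finset.mul_sum, map_sum]
    refine Finset.sum_congr rfl fun α _ => ?_
    obtain ⟨e, rfl⟩ : ∃ e : Fin n →₀ ℕ, α = fun i => e i :=
      ⟨Finsupp.equivFunOnFinite.symm α, by ext; simp⟩
    have hX : (∏ j, X j ^ e j : MvPolynomial (Fin n) k) = monomial e 1 := by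
      rw [monomial_eq, Finsupp.prod_fintype _ _ (by simp)]; simp
    rw [pdp_monomial, hX, monomial_mul, one_mul, ← map_natCast (C : k →+* MvPolynomial (Fin n) k),
      C_mul_monomial]
    by_cases h : e ≤ m
    · rw [add_tsub_cancel_of_le h]
      congr 1
      push_cast
      ring
    · obtain ⟨i, hi⟩ : ∃ i, m i < e i := by
        by_contra! hc
        exact h hc
      have h0 : (∏ i, (m i).descFactorial (e i)) = 0 :=
        Finset.prod_eq_zero (Finset.mem_univ i) (Nat.descFactorial_eq_zero_iff_lt.2 hi)
      have h1 : (∏ i, ((m i).descFactorial (e i) : k)) = 0 := by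
        rw [← Nat.cast_prod, h0, Nat.cast_zero]
      rw [h0, h1]
      simp

end BFun

/-- If `p_1,…,p_n` are homogeneous polynomials in `n` variables over an
algebraically closed field of characteristic `0` whose common zero set is
exactly `{0}`, and `M = Σ deg p_i`, `N = M - n + 1`, then there are polynomials
`q_{i,α}` (for `|α| = N`) with
`θ(θ-1)⋯(θ-(M-n)) f = Σ_{|α|=N} Σ_i (N!/α!) · x^α · q_{i,α}(∂)(p_i(∂) f)`
for all `f`; i.e. `b(T) = T(T-1)⋯(T-(M-n))` is a monodromic `b`-function along
`{0}` for the system `p_1(∂)u = ⋯ = p_n(∂)u = 0`. -/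
theorem exists_monodromic_bFunction_of_common_zero_eq_zero
    {k : Type*} [Field k] [IsAlgClosed k] [CharZero k] {n : ℕ}
    (p : Fin n → MvPolynomial (Fin n) k) (deg : Fin n → ℕ)
    (hp : ∀ i, (p i).IsHomogeneous (deg i))
    (hz : {ξ : Fin n → k | ∀ i, eval ξ (p i) = 0} = {0}) :
    ∃ q : Fin n → (Fin n → ℕ) → MvPolynomial (Fin n) k,
      ∀ f : MvPolynomial (Fin n) k,
        eulerFactorial ((∑ i, deg i) - n + 1) f =
          ∑ α ∈ Finset.Nat.antidiagonalTuple n ((∑ i, deg i) - n + 1), ∑ i,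
            (Nat.multinomial Finset.univ α : MvPolynomial (Fin n) k) *
              ((∏ j, X j ^ α j) * diffOp (q i α) (diffOp (p i) f)) := by
  classical
  have hM := BFun.macaulay p deg hp hz
  set N := (∑ i, deg i) - n + 1 with hN
  have key : ∀ α : Fin n → ℕ, ∃ c : Fin n → MvPolynomial (Fin n) k,
      (∑ i, α i = N) → ∑ i, c i * p i = monomial (Finsupp.equivFunOnFinite.symm α) 1 := by
    intro α
    by_cases hα : ∑ i, α i = N
    · have hmem := hM N le_rfl (monomial (Finsupp.equivFunOnFinite.symm α) (1 : k))
        (isHomogeneous_monomial _ (by rw [Finsupp.degree_eq_sum]; simpa using hα))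
      obtain ⟨c, hc⟩ := Ideal.mem_span_range_iff_exists_fun.1 hmem
      exact ⟨c, fun _ => hc⟩
    · exact ⟨0, fun h => absurd h hα⟩
  choose c hc using key
  refine ⟨fun i α => c α i, fun f => ?_⟩
  rw [BFun.ef_eq]
  refine Finset.sum_congr rfl fun α hα => ?_
  rw [Finset.Nat.mem_antidiagonalTuple] at hα
  have h1 : partialDerivPow α f = ∑ i, diffOp (c α i) (diffOp (p i) f) := by
    have h2 := BFun.diffOp_monomial (Finsupp.equivFunOnFinite.symm α) (1 : k) f
    rw [← hc α hα, BFun.diffOp_sum] at h2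
    simp_rw [BFun.diffOp_mul] at h2
    rw [h2]
    simp
  rw [h1, Finset.mul_sum, Finset.mul_sum]
end

section
/- Let k be an algebraically closed field of characteristic 0, and let p_1,…,p_n ∈ k[x_1,…,x_n] be homogeneous polynomials whose common zero set in k^n is exactly {0}. Let M = deg p_1 + ⋯ + deg p_n. Then every polynomial f ∈ k[x_1,…,x_n] satisfying p_i(∂) f = 0 for all i = 1,…,n has total degree at most M − n. -/
open MvPolynomial

section MacaulayBound

attribute [local instance] MvPolynomial.gradedAlgebra

variable {k : Type*} [Field k] {n : ℕ}

/-- `z` is a nonzerodivisor modulo the ideal generated by `s`. -/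
def NZ (z : MvPolynomial (Fin n) k) (s : Set (MvPolynomial (Fin n) k)) : Prop :=
  ∀ w, z * w ∈ Ideal.span s → w ∈ Ideal.span s

/-- All elements of `s` are homogeneous. -/
def HomSet (s : Set (MvPolynomial (Fin n) k)) : Prop :=
  ∀ x ∈ s, ∃ d, x.IsHomogeneous d

lemma HomSet.isHomogeneous {s : Set (MvPolynomial (Fin n) k)} (hs : HomSet s) :
    (Ideal.span s).IsHomogeneous (homogeneousSubmodule (Fin n) k) := by
  apply Ideal.homogeneous_span
  intro x hx
  obtain ⟨d, hd⟩ := hs x hx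
  exact ⟨d, hd⟩

lemma HomSet.insert {s : Set (MvPolynomial (Fin n) k)} (hs : HomSet s)
    {a : MvPolynomial (Fin n) k} {d : ℕ} (ha : a.IsHomogeneous d) : HomSet (insert a s) := by
  rintro x (rfl | hx)
  · exact ⟨d, ha⟩
  · exact hs x hx

lemma comp_mul {z : MvPolynomial (Fin n) k} {d : ℕ} (hz : z.IsHomogeneous d)
    (w : MvPolynomial (Fin n) k) (D : ℕ) :
    homogeneousComponent (D + d) (z * w) = z * homogeneousComponent D w := by
  conv_lhs => rw [← sum_homogeneousComponent w]
  rw [Finset.mul_sum, map_sum]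
  have h : ∀ i, homogeneousComponent (D + d) (z * homogeneousComponent i w)
      = if i = D then z * homogeneousComponent D w else 0 := by
    intro i
    rw [homogeneousComponent_of_mem (hz.mul (homogeneousComponent_isHomogeneous i w))]
    by_cases hi : i = D
    · subst hi
      simp [add_comm]
    · rw [if_neg hi, if_neg (by omega)]
  simp only [h]
  rw [Finset.sum_ite_eq']
  split_ifs with h1
  · rfl
  · rw [homogeneousComponent_eq_zero, mul_zero]
    simpa using h1

lemma comp_mul_lt {z : MvPolynomial (Fin n) k} {d : ℕ} (hz : z.IsHomogeneous d)
    (w : MvPolynomial (Fin n) k) (D : ℕ) (hD : D < d) :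
    homogeneousComponent D (z * w) = 0 := by
  conv_lhs => rw [← sum_homogeneousComponent w]
  rw [Finset.mul_sum, map_sum]
  apply Finset.sum_eq_zero
  intro i _
  rw [homogeneousComponent_of_mem (hz.mul (homogeneousComponent_isHomogeneous i w))]
  rw [if_neg (by omega)]

lemma hom_lift {s : Set (MvPolynomial (Fin n) k)} (hs : HomSet s)
    {a w : MvPolynomial (Fin n) k} {d D : ℕ} (ha : a.IsHomogeneous d) (hw : w.IsHomogeneous D)
    (h : w ∈ Ideal.span (insert a s)) :
    w ∈ Ideal.span s ∨ (d ≤ D ∧ ∃ v, v.IsHomogeneous (D - d) ∧ w - a * v ∈ Ideal.span s) := by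
  obtain ⟨v, j, hj, rfl⟩ := Ideal.mem_span_insert.1 h
  have hjD := homogeneousComponent_mem_of_mem hs.isHomogeneous hj D
  have e := homogeneousComponent_of_mem (m := D) hw
  rw [if_pos rfl, map_add, mul_comm] at e
  by_cases hD : D < d
  · left
    rw [comp_mul_lt ha _ _ hD, zero_add, mul_comm] at e
    rwa [← e]
  · right
    refine ⟨by omega, homogeneousComponent (D - d) v, homogeneousComponent_isHomogeneous _ _, ?_⟩
    have := comp_mul ha v (D - d)
    rw [Nat.sub_add_cancel (by omega)] at this
    rw [this, mul_comm a v] at e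
    rw [← e]
    simpa using hjD

lemma NZ.of_insert {s : Set (MvPolynomial (Fin n) k)} (hs : HomSet s)
    {a z : MvPolynomial (Fin n) k} {d e : ℕ} (ha : a.IsHomogeneous d) (hd : 0 < d)
    (hz : z.IsHomogeneous e) (h1 : NZ a s) (h2 : NZ z (insert a s)) : NZ z s := by
  have key : ∀ D, ∀ w : MvPolynomial (Fin n) k, w.IsHomogeneous D → z * w ∈ Ideal.span s →
      w ∈ Ideal.span s := by
    intro D
    induction D using Nat.strong_induction_on with
    | _ D ih =>
      intro w hw hzw
      have := h2 w (Ideal.span_mono (Set.subset_insert _ _) hzw)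
      rcases hom_lift hs ha hw this with h | ⟨hle, v, hv, hwv⟩
      · exact h
      · have h3 : a * (z * v) ∈ Ideal.span s := by
          have : a * (z * v) = z * w - z * (w - a * v) := by ring
          rw [this]
          exact Ideal.sub_mem _ hzw (Ideal.mul_mem_left _ _ hwv)
        have h4 := ih (D - d) (by omega) v hv (h1 _ h3)
        have : w = (w - a * v) + a * v := by ring
        rw [this]
        exact Ideal.add_mem _ hwv (Ideal.mul_mem_left _ _ h4)
  intro w hw
  rw [mem_iff_homogeneousComponent_mem hs.isHomogeneous]
  intro D
  apply key D _ (homogeneousComponent_isHomogeneous _ _)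
  rw [← comp_mul hz]
  exact homogeneousComponent_mem_of_mem hs.isHomogeneous hw _

lemma NZ.swap {s : Set (MvPolynomial (Fin n) k)}
    {y z : MvPolynomial (Fin n) k} (h1 : NZ y s) (h2 : NZ z (insert y s)) : NZ y (insert z s) := by
  intro u hu
  obtain ⟨v, j, hj, e⟩ := Ideal.mem_span_insert.1 hu
  have h3 : z * v ∈ Ideal.span (insert y s) :=
    Ideal.mem_span_insert.2 ⟨u, -j, neg_mem hj, by linear_combination -e⟩
  obtain ⟨v', j', hj', e'⟩ := Ideal.mem_span_insert.1 (h2 _ h3)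
  have h4 : y * (u - z * v') ∈ Ideal.span s := by
    have : y * (u - z * v') = j + z * j' := by linear_combination e + z * e'
    rw [this]
    exact Ideal.add_mem _ hj (Ideal.mul_mem_left _ _ hj')
  exact Ideal.mem_span_insert.2 ⟨v', _, h1 _ h4, by ring⟩

lemma NZ.exchange {s : Set (MvPolynomial (Fin n) k)}
    {y z : MvPolynomial (Fin n) k} (h1 : NZ y s) (h : y ∈ (Ideal.span (insert z s)).radical) :
    NZ z s := by
  obtain ⟨N, hN⟩ := h
  obtain ⟨c, j, hj, e⟩ := Ideal.mem_span_insert.1 hN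
  intro w hw
  have h2 : y ^ N * w ∈ Ideal.span s := by
    have : y ^ N * w = c * (z * w) + w * j := by rw [e]; ring
    rw [this]
    exact Ideal.add_mem _ (Ideal.mul_mem_left _ _ hw) (Ideal.mul_mem_left _ _ hj)
  clear hN e
  induction N with
  | zero => simpa using h2
  | succ N ih =>
    apply ih
    apply h1
    convert h2 using 1
    ring

/-- Every subset is a regular sequence in every order. -/
def Reg (y : Fin n → MvPolynomial (Fin n) k) : Prop :=
  ∀ T : Set (Fin n), ∀ i ∉ T, NZ (y i) (y '' T)

lemma image_update_of_notMem {y : Fin n → MvPolynomial (Fin n) k} {i : Fin n}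
    {z : MvPolynomial (Fin n) k} {T : Set (Fin n)} (hi : i ∉ T) :
    Function.update y i z '' T = y '' T := by
  apply Set.image_congr
  intro j hj
  rw [Function.update_of_ne]
  rintro rfl
  exact hi hj

lemma image_update_of_mem {y : Fin n → MvPolynomial (Fin n) k} {i : Fin n}
    {z : MvPolynomial (Fin n) k} {T : Set (Fin n)} (hi : i ∈ T) :
    Function.update y i z '' T = insert z (y '' (T \ {i})) := by
  conv_lhs => rw [← Set.insert_sdiff_self_of_mem hi]
  rw [Set.image_insert_eq, image_update_of_notMem (by simp), Function.update_self]

lemma range_update_eq {y : Fin n → MvPolynomial (Fin n) k} {i : Fin n}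
    {z : MvPolynomial (Fin n) k} :
    Set.range (Function.update y i z) = insert z (y '' {i}ᶜ) := by
  rw [← Set.image_univ, image_update_of_mem (Set.mem_univ i), Set.compl_eq_univ_sdiff]

lemma range_eq_insert (y : Fin n → MvPolynomial (Fin n) k) (i : Fin n) :
    Set.range y = insert (y i) (y '' {i}ᶜ) := by
  rw [← range_update_eq, Function.update_eq_self]

lemma Reg.update {y : Fin n → MvPolynomial (Fin n) k} {d : Fin n → ℕ}
    (hy : ∀ j, (y j).IsHomogeneous (d j)) (hd : ∀ j, 0 < d j) (h : Reg y)
    {i : Fin n} {z : MvPolynomial (Fin n) k} {e : ℕ} (hz : z.IsHomogeneous e)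
    (hr : y i ∈ (Ideal.span (insert z (y '' {i}ᶜ))).radical) :
    Reg (Function.update y i z) := by
  have hS : ∀ T : Set (Fin n), HomSet (y '' T) := by
    rintro T x ⟨j, -, rfl⟩
    exact ⟨_, hy j⟩
  have h0 : NZ z (y '' {i}ᶜ) := (h {i}ᶜ i (by simp)).exchange hr
  have h1 : ∀ U : Finset (Fin n), NZ z (y '' {j | j ≠ i ∧ j ∉ U}) := by
    intro U
    induction U using Finset.induction_on with
    | empty =>
      convert h0 using 2
      ext j
      simp
    | insert a U ha ih =>
      by_cases hai : a = i
      · convert ih using 2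
        ext j
        simp only [Finset.mem_insert, Set.mem_ofPred_eq]
        subst hai
        tauto
      · refine NZ.of_insert (hS _) (hy a) (hd a) hz (h _ a (by simp)) ?_
        rw [← Set.image_insert_eq]
        convert ih using 2
        ext j
        simp only [Finset.mem_insert, Set.mem_ofPred_eq, Set.mem_insert_iff]
        by_cases hja : j = a
        · subst hja; tauto
        · tauto
  have h2 : ∀ T : Set (Fin n), i ∉ T → NZ z (y '' T) := by
    classical
    intro T hT
    convert h1 (Finset.univ.filter (· ∉ T)) using 2
    ext j
    simp only [Finset.mem_filter, Finset.mem_univ, true_and, not_not, Set.mem_ofPred_eq]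
    constructor
    · intro hj
      exact ⟨fun h => hT (h ▸ hj), hj⟩
    · exact fun h => h.2
  intro T l hl
  by_cases hli : l = i
  · subst hli
    rw [Function.update_self, image_update_of_notMem hl]
    exact h2 T hl
  · rw [Function.update_of_ne hli]
    by_cases hiT : i ∈ T
    · rw [image_update_of_mem hiT]
      apply NZ.swap
      · exact h _ l (fun h => hl h.1)
      · rw [← Set.image_insert_eq]
        apply h2
        rintro (h | h)
        · exact hli h.symm
        · exact h.2 rfl
    · rw [image_update_of_notMem hiT]
      exact h T l hl

/-- The `D`-th graded piece of the quotient by the ideal `J`. -/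
noncomputable def gradedPiece (J : Ideal (MvPolynomial (Fin n) k)) (D : ℕ) :
    Submodule k (MvPolynomial (Fin n) k ⧸ J) :=
  (homogeneousSubmodule (Fin n) k D).map (Ideal.Quotient.mkₐ k J).toLinearMap

instance (J : Ideal (MvPolynomial (Fin n) k)) (D : ℕ) :
    Module.Finite k (gradedPiece J D) := by
  rw [Module.Finite.iff_fg]
  exact (homogeneousSubmodule_fg (Fin n) k D).map _

/-- Multiplication by `z` on the quotient. -/
noncomputable def mulQ (J : Ideal (MvPolynomial (Fin n) k)) (z : MvPolynomial (Fin n) k) :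
    (MvPolynomial (Fin n) k ⧸ J) →ₗ[k] (MvPolynomial (Fin n) k ⧸ J) :=
  LinearMap.mulLeft k (Ideal.Quotient.mk J z)

lemma mulQ_injective {s : Set (MvPolynomial (Fin n) k)} {z : MvPolynomial (Fin n) k}
    (h : NZ z s) : Function.Injective (mulQ (Ideal.span s) z) := by
  rw [injective_iff_map_eq_zero]
  intro a ha
  obtain ⟨w, rfl⟩ := Ideal.Quotient.mk_surjective a
  change Ideal.Quotient.mk _ z * Ideal.Quotient.mk _ w = 0 at ha
  rw [← map_mul, Ideal.Quotient.eq_zero_iff_mem] at ha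
  exact Ideal.Quotient.eq_zero_iff_mem.2 (h w ha)

lemma map_mulQ_le (J : Ideal (MvPolynomial (Fin n) k)) {z : MvPolynomial (Fin n) k} {e : ℕ}
    (hz : z.IsHomogeneous e) (D : ℕ) :
    (gradedPiece J D).map (mulQ J z) ≤ gradedPiece J (D + e) := by
  rintro _ ⟨_, ⟨w, hw, rfl⟩, rfl⟩
  refine ⟨z * w, ?_, ?_⟩
  · rw [add_comm]
    exact hz.mul hw
  · exact map_mul (Ideal.Quotient.mk J) z w

lemma finrank_map_mulQ {s : Set (MvPolynomial (Fin n) k)} {z : MvPolynomial (Fin n) k}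
    (h : NZ z s) (D : ℕ) :
    Module.finrank k ((gradedPiece (Ideal.span s) D).map (mulQ (Ideal.span s) z)) =
      Module.finrank k (gradedPiece (Ideal.span s) D) :=
  (Submodule.equivMapOfInjective _ (mulQ_injective h) _).finrank_eq.symm

lemma finrank_mono {s : Set (MvPolynomial (Fin n) k)} {z : MvPolynomial (Fin n) k} {e : ℕ}
    (hz : z.IsHomogeneous e) (h : NZ z s) (D : ℕ) :
    Module.finrank k (gradedPiece (Ideal.span s) D) ≤
      Module.finrank k (gradedPiece (Ideal.span s) (D + e)) := by
  rw [← finrank_map_mulQ h]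
  exact Submodule.finrank_mono (map_mulQ_le _ hz D)

lemma finrank_eq_of {s : Set (MvPolynomial (Fin n) k)} (hs : HomSet s)
    {z : MvPolynomial (Fin n) k} {e : ℕ}
    (hz : z.IsHomogeneous e) (h : NZ z s) (D : ℕ)
    (hall : ∀ w : MvPolynomial (Fin n) k, w.IsHomogeneous (D + e) → w ∈ Ideal.span (insert z s)) :
    Module.finrank k (gradedPiece (Ideal.span s) (D + e)) =
      Module.finrank k (gradedPiece (Ideal.span s) D) := by
  rw [← finrank_map_mulQ h D]
  have key : gradedPiece (Ideal.span s) (D + e) =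
      (gradedPiece (Ideal.span s) D).map (mulQ (Ideal.span s) z) := ?_
  · rw [key]
  refine le_antisymm ?_ (map_mulQ_le _ hz D)
  rintro _ ⟨w, hw, rfl⟩
  rcases hom_lift hs hz hw (hall w hw) with h | ⟨-, v, hv, hwv⟩
  · have : (Ideal.Quotient.mkₐ k (Ideal.span s)).toLinearMap w = 0 :=
      Ideal.Quotient.eq_zero_iff_mem.2 h
    rw [this]
    exact zero_mem _
  · rw [Nat.add_sub_cancel] at hv
    refine ⟨_, ⟨v, hv, rfl⟩, ?_⟩
    change Ideal.Quotient.mk _ z * Ideal.Quotient.mk _ v = Ideal.Quotient.mk _ w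
    rw [← map_mul, eq_comm, Ideal.Quotient.eq]
    exact hwv

lemma mem_of_finrank_eq {s : Set (MvPolynomial (Fin n) k)}
    {z : MvPolynomial (Fin n) k} {e : ℕ}
    (hz : z.IsHomogeneous e) (h : NZ z s) (D : ℕ)
    (heq : Module.finrank k (gradedPiece (Ideal.span s) (D + e)) =
      Module.finrank k (gradedPiece (Ideal.span s) D))
    (w : MvPolynomial (Fin n) k) (hw : w.IsHomogeneous (D + e)) :
    w ∈ Ideal.span (insert z s) := by
  rw [← finrank_map_mulQ h D] at heq
  have := Submodule.eq_of_le_of_finrank_eq (map_mulQ_le (Ideal.span s) hz D) heq.symm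
  have hmem : Ideal.Quotient.mk (Ideal.span s) w ∈ gradedPiece (Ideal.span s) (D + e) :=
    ⟨w, hw, rfl⟩
  rw [← this] at hmem
  obtain ⟨_, ⟨v, hv, rfl⟩, hvw⟩ := hmem
  change Ideal.Quotient.mk _ z * Ideal.Quotient.mk _ v = Ideal.Quotient.mk _ w at hvw
  rw [← map_mul, eq_comm, Ideal.Quotient.eq] at hvw
  exact Ideal.mem_span_insert.2 ⟨v, _, hvw, by ring⟩

/-- Homogeneous systems of parameters. -/
structure Hsop (y : Fin n → MvPolynomial (Fin n) k) (d : Fin n → ℕ) : Prop where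
  hom : ∀ i, (y i).IsHomogeneous (d i)
  pos : ∀ i, 0 < d i
  rad : ∀ j, X j ∈ (Ideal.span (Set.range y)).radical

/-- Homogeneous systems of parameters that are regular and satisfy the degree bound. -/
structure Good (y : Fin n → MvPolynomial (Fin n) k) (d : Fin n → ℕ) : Prop extends Hsop y d where
  reg : Reg y
  bound : ∀ D, ∑ i, d i < D + n → ∀ w : MvPolynomial (Fin n) k, w.IsHomogeneous D →
    w ∈ Ideal.span (Set.range y)

lemma ker_le_of_X_mem {I : Ideal (MvPolynomial (Fin n) k)} (h : ∀ j, X j ∈ I) :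
    RingHom.ker (constantCoeff (R := k) (σ := Fin n)) ≤ I := by
  intro f hf
  have h1 : f ∈ Ideal.span (X '' (Set.univ : Set (Fin n)) : Set (MvPolynomial (Fin n) k)) := by
    rw [mem_ideal_span_X_image]
    intro m hm
    by_contra! hc
    have : m = 0 := by
      ext i
      exact hc i (Set.mem_univ i)
    subst this
    exact (mem_support_iff.1 hm) hf
  refine (Ideal.span_le.2 ?_) h1
  rintro _ ⟨j, -, rfl⟩
  exact h j

lemma mem_ker_of_hom {f : MvPolynomial (Fin n) k} {d : ℕ} (hf : f.IsHomogeneous d) (hd : 0 < d) :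
    f ∈ RingHom.ker (constantCoeff (R := k) (σ := Fin n)) := by
  change coeff 0 f = 0
  apply hf.coeff_eq_zero
  simp
  omega

lemma Good.exchange {y : Fin n → MvPolynomial (Fin n) k} {d : Fin n → ℕ} (h : Good y d)
    {i : Fin n} {z : MvPolynomial (Fin n) k} {e : ℕ}
    (h' : Hsop (Function.update y i z) (Function.update d i e)) :
    Good (Function.update y i z) (Function.update d i e) := by
  have hz : z.IsHomogeneous e := by simpa using h'.hom i
  have he : 0 < e := by simpa using h'.pos i
  have hr := h'.rad
  rw [range_update_eq] at hr
  have hreg : Reg (Function.update y i z) := by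
    refine h.reg.update h.hom h.pos hz ?_
    exact ker_le_of_X_mem hr (mem_ker_of_hom (h.hom i) (h.pos i))
  refine ⟨h', hreg, ?_⟩
  set s := y '' {i}ᶜ with hs
  have hS : HomSet s := by
    rintro x ⟨j, -, rfl⟩
    exact ⟨_, h.hom j⟩
  have hNy : NZ (y i) s := h.reg _ i (by simp)
  have hNz : NZ z s := by
    have := hreg {i}ᶜ i (by simp)
    rwa [Function.update_self, image_update_of_notMem (by simp)] at this
  have hbound := h.bound
  rw [range_eq_insert y i] at hbound
  rw [range_update_eq]
  have hsum : ∑ j, d j = d i + ∑ j ∈ Finset.univ.erase i, d j :=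
    (Finset.add_sum_erase _ _ (Finset.mem_univ i)).symm
  have hsum' : ∑ j, Function.update d i e j = e + ∑ j ∈ Finset.univ.erase i, d j := by
    rw [← Finset.add_sum_erase _ _ (Finset.mem_univ i), Function.update_self]
    congr 1
    apply Finset.sum_congr rfl
    intro j hj
    rw [Function.update_of_ne (Finset.ne_of_mem_erase hj)]
  have hcard : n - 1 ≤ ∑ j ∈ Finset.univ.erase i, d j := by
    calc n - 1 = ∑ j ∈ Finset.univ.erase i, 1 := by simp
      _ ≤ _ := Finset.sum_le_sum (fun j _ => h.pos j)
  set E := ∑ j ∈ Finset.univ.erase i, d j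
  have hper : ∀ D, E < D + n → Module.finrank k (gradedPiece (Ideal.span s) (D + d i)) =
      Module.finrank k (gradedPiece (Ideal.span s) D) := by
    intro D hD
    apply finrank_eq_of hS (h.hom i) hNy
    intro w hw
    exact hbound _ (by omega) w hw
  have hper2 : ∀ m D, E < D + n → Module.finrank k (gradedPiece (Ideal.span s) (D + m * d i)) =
      Module.finrank k (gradedPiece (Ideal.span s) D) := by
    intro m
    induction m with
    | zero => intro D _; rw [zero_mul, add_zero]
    | succ m ih =>
      intro D hD
      rw [show D + (m + 1) * d i = (D + m * d i) + d i by ring, hper _ (by omega), ih D hD]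
  have hmono : ∀ m D, Module.finrank k (gradedPiece (Ideal.span s) D) ≤
      Module.finrank k (gradedPiece (Ideal.span s) (D + m * e)) := by
    intro m
    induction m with
    | zero => intro D; rw [zero_mul, add_zero]
    | succ m ih =>
      intro D
      rw [show D + (m + 1) * e = (D + m * e) + e by ring]
      exact (ih D).trans (finrank_mono hz hNz _)
  intro D hD w hw
  rw [hsum'] at hD
  have hn : 0 < n := i.pos
  obtain ⟨D, rfl⟩ : ∃ D', D = D' + e := ⟨D - e, by omega⟩
  refine mem_of_finrank_eq hz hNz D (le_antisymm ?_ (finrank_mono hz hNz D)) w hw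
  have h1 := hmono (d i - 1) (D + e)
  have h2 := hper2 e D (by omega)
  have h3 : D + e + (d i - 1) * e = D + e * d i := by
    obtain ⟨c, hc⟩ : ∃ c, d i = c + 1 := ⟨d i - 1, by have := h.pos i; omega⟩
    rw [hc, Nat.add_sub_cancel]
    ring
  rw [h3, h2] at h1
  exact h1

lemma good_X : Good (fun i : Fin n => (X i : MvPolynomial (Fin n) k)) (fun _ => 1) := by
  refine ⟨⟨fun i => isHomogeneous_X _ _, fun _ => one_pos, fun j => Ideal.le_radical
    (Ideal.subset_span ⟨j, rfl⟩)⟩, ?_, ?_⟩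
  · intro T i hi w hw
    rw [mem_ideal_span_X_image] at hw ⊢
    intro m hm
    have : m + Finsupp.single i 1 ∈ (X i * w).support := by
      rw [mem_support_iff] at hm ⊢
      rwa [mul_comm, coeff_mul_X]
    obtain ⟨j, hj, hne⟩ := hw _ this
    refine ⟨j, hj, ?_⟩
    have hij : i ≠ j := by
      rintro rfl
      exact hi hj
    simpa [Finsupp.single_apply, hij] using hne
  · intro D hD w hw
    have hD' : 0 < D := by simpa using hD
    refine ker_le_of_X_mem ?_ (mem_ker_of_hom hw hD')
    intro j
    exact Ideal.subset_span ⟨j, rfl⟩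

lemma exists_avoid [Infinite k] {a b : Fin n → MvPolynomial (Fin n) k} {d d' : Fin n → ℕ}
    (ha : Hsop a d') (hb : Hsop b d) (i : Fin n)
    (hda : ∀ j, d' j = 1) :
    ∃ c : Fin n → k, c i ≠ 0 ∧
      ∀ j, X j ∈ (Ideal.span (insert (∑ l, c l • a l) (b '' {i}ᶜ))).radical := by
  classical
  set m := RingHom.ker (constantCoeff (R := k) (σ := Fin n)) with hm
  have hmp : m.IsPrime := RingHom.ker_isPrime _
  set J := Ideal.span (b '' {i}ᶜ) with hJ
  have hS : HomSet (b '' {i}ᶜ) := by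
    rintro x ⟨j, -, rfl⟩
    exact ⟨_, hb.hom j⟩
  let L : (Fin n → k) →ₗ[k] MvPolynomial (Fin n) k := Fintype.linearCombination k a
  have hL : ∀ c, L c = ∑ l, c l • a l := fun c => Fintype.linearCombination_apply k a c
  let W : Ideal (MvPolynomial (Fin n) k) → Subspace k (Fin n → k) :=
    fun P => (P.restrictScalars k).comap L
  have hfin : J.minimalPrimes.Finite := Ideal.finite_minimalPrimes_of_isNoetherianRing _ J
  let S : Finset (Subspace k (Fin n → k)) :=
    insert (LinearMap.ker (LinearMap.proj i)) ((hfin.toFinset.filter (fun P => ¬ m ≤ P)).image W)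
  have hStop : ⊤ ∉ S := by
    intro h
    rcases Finset.mem_insert.1 h with h | h
    · have : (Pi.single i 1 : Fin n → k) ∈ LinearMap.ker (LinearMap.proj (R := k) (φ := fun _ => k) i) := by
        rw [← h]; trivial
      simp at this
    · obtain ⟨P, hP, hPt⟩ := Finset.mem_image.1 h
      rw [Finset.mem_filter, Set.Finite.mem_toFinset] at hP
      have hPp : P.IsPrime := hP.1.1.1
      apply hP.2
      apply ker_le_of_X_mem
      intro j
      refine (hPp.isRadical.radical_le_iff.2 ?_) (ha.rad j)
      rw [Ideal.span_le]
      rintro _ ⟨l, rfl⟩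
      have : (Pi.single l 1 : Fin n → k) ∈ W P := by rw [hPt]; trivial
      have h2 : L (Pi.single l 1) ∈ P := this
      simpa [hL, Pi.single_apply] using h2
  obtain ⟨c, hc⟩ := (Set.ne_univ_iff_exists_notMem _).1
    (Subspace.biUnion_ne_univ_of_top_notMem hStop)
  have hc' : ∀ V ∈ S, c ∉ V := by
    intro V hV hcV
    apply hc
    simp only [Set.mem_iUnion]
    exact ⟨V, hV, hcV⟩
  refine ⟨c, ?_, ?_⟩
  · have := hc' _ (Finset.mem_insert_self _ _)
    simpa using this
  set z := ∑ l, c l • a l with hz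
  have hzh : z.IsHomogeneous 1 := by
    apply IsHomogeneous.sum
    intro l _
    rw [smul_eq_C_mul]
    have := ha.hom l
    rw [hda] at this
    exact this.C_mul _
  have hzP : ∀ P ∈ J.minimalPrimes, z ∈ P → m ≤ P := by
    intro P hP hzP
    by_contra hmP
    refine hc' (W P) (Finset.mem_insert_of_mem (Finset.mem_image_of_mem _ ?_)) ?_
    · rw [Finset.mem_filter, Set.Finite.mem_toFinset]
      exact ⟨hP, hmP⟩
    · change L c ∈ P
      rwa [hL]
  have hmX : ∀ j, X j ∈ m := fun j => mem_ker_of_hom (isHomogeneous_X k j) one_pos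
  have hbm : ∀ j, b j ∈ m := fun j => mem_ker_of_hom (hb.hom j) (hb.pos j)
  have hmin : m ∈ (Ideal.span (insert (b i) (b '' {i}ᶜ))).minimalPrimes := by
    rw [← range_eq_insert]
    refine ⟨⟨hmp, ?_⟩, ?_⟩
    · rw [Ideal.span_le]
      rintro _ ⟨j, rfl⟩
      exact hbm j
    · rintro Q ⟨hQ, hQb⟩ -
      exact ker_le_of_X_mem (fun j => hQ.isRadical.radical_le_iff.2 hQb (hb.rad j))
  intro j
  rw [Ideal.radical_eq_sInf, Submodule.mem_sInf]
  rintro Q ⟨hQ, hQp⟩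
  let Q' := (Ideal.homogeneousCore (homogeneousSubmodule (Fin n) k) Q).toIdeal
  have hQ'p : Q'.IsPrime := Ideal.IsPrime.homogeneousCore hQp
  have hQ'Q : Q' ≤ Q := Ideal.toIdeal_homogeneousCore_le _ Q
  have hQ'h : Q'.IsHomogeneous (homogeneousSubmodule (Fin n) k) :=
    (Ideal.homogeneousCore (homogeneousSubmodule (Fin n) k) Q).isHomogeneous
  have hmem : ∀ x ∈ insert z (b '' {i}ᶜ), x ∈ Q' := by
    intro x hx
    obtain ⟨e, he⟩ := hS.insert hzh x hx
    exact Ideal.mem_homogeneousCore_of_homogeneous_of_mem ⟨e, he⟩ (hQ (Ideal.subset_span hx))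
  have hQ'm : Q' ≤ m := by
    intro f hf
    have h0 := homogeneousComponent_mem_of_mem hQ'h hf 0
    rw [homogeneousComponent_zero] at h0
    by_contra hne
    have hne' : coeff 0 f ≠ 0 := hne
    apply hQ'p.ne_top
    exact Ideal.eq_top_of_isUnit_mem _ h0 ((isUnit_iff_ne_zero.2 hne').map C)
  apply hQ'Q
  by_contra hXQ
  have hlt : Q' < m := lt_of_le_of_ne hQ'm (by rintro h; exact hXQ (h ▸ hmX j))
  have hq := Ideal.mem_minimalPrimes_span_of_mem_minimalPrimes_span_insert hlt (b i) _ hmin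
    (b '' {i}ᶜ) (fun x hx => hmem x (Set.mem_insert_of_mem _ hx))
    (fun x hx => Ideal.le_radical (Ideal.subset_span (Set.mem_insert_of_mem _ hx)))
  exact hXQ (hzP Q' hq (hmem z (Set.mem_insert _ _)) (hmX j))

lemma good_of_agree [Infinite k] (N : ℕ) :
    ∀ (a b : Fin n → MvPolynomial (Fin n) k) (d : Fin n → ℕ),
      Good a (fun _ => 1) → Hsop b d → (∀ j : Fin n, N ≤ j → a j = b j ∧ d j = 1) → Good b d := by
  induction N with
  | zero =>
    intro a b d ha hb h
    obtain rfl : a = b := funext fun j => (h j (Nat.zero_le _)).1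
    obtain rfl : d = fun _ => 1 := funext fun j => (h j (Nat.zero_le _)).2
    exact ha
  | succ N ih =>
    intro a b d ha hb h
    by_cases hN : N < n
    swap
    · exact ih a b d ha hb (fun j hj => absurd j.2 (by omega))
    let i : Fin n := ⟨N, hN⟩
    obtain ⟨c, hci, hc⟩ := exists_avoid ha.toHsop hb i (fun _ => rfl)
    set z := ∑ l, c l • a l with hz
    have hzh : z.IsHomogeneous 1 := by
      apply IsHomogeneous.sum
      intro l _
      rw [smul_eq_C_mul]
      exact (ha.hom l).C_mul _
    have ha'h : Hsop (Function.update a i z) (Function.update (fun _ => 1) i 1) := by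
      refine ⟨?_, ?_, ?_⟩
      · intro j
        by_cases hj : j = i
        · subst hj; simpa using hzh
        · simpa [Function.update_of_ne hj] using ha.hom j
      · simp
      · intro j
        refine Ideal.radical_mono ?_ (ha.rad j)
        rw [range_update_eq, Ideal.span_le]
        have hother : ∀ l, l ≠ i → a l ∈ Ideal.span (insert z (a '' {i}ᶜ)) := fun l hl =>
          Ideal.subset_span (Set.mem_insert_of_mem _ ⟨l, hl, rfl⟩)
        rintro _ ⟨l, rfl⟩
        by_cases hl : l = i
        · rw [hl]
          have h1 : c i • a i ∈ Ideal.span (insert z (a '' {i}ᶜ)) := by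
            have : c i • a i = z - ∑ r ∈ Finset.univ.erase i, c r • a r := by
              rw [hz, ← Finset.add_sum_erase _ _ (Finset.mem_univ i)]
              ring
            rw [this]
            refine Ideal.sub_mem _ (Ideal.subset_span (Set.mem_insert _ _)) ?_
            refine Ideal.sum_mem _ fun r hr => ?_
            rw [smul_eq_C_mul]
            exact Ideal.mul_mem_left _ _ (hother r (Finset.ne_of_mem_erase hr))
          have h2 := Ideal.mul_mem_left _ (C (c i)⁻¹) h1
          rw [smul_eq_C_mul, ← mul_assoc, ← C_mul, inv_mul_cancel₀ hci, C_1, one_mul] at h2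
          exact h2
        · exact hother l hl
    have ha' := ha.exchange ha'h
    rw [Function.update_eq_self] at ha'
    have hb'h : Hsop (Function.update b i z) (Function.update d i 1) := by
      refine ⟨?_, ?_, ?_⟩
      · intro j
        by_cases hj : j = i
        · subst hj; simpa using hzh
        · simpa [Function.update_of_ne hj] using hb.hom j
      · intro j
        by_cases hj : j = i
        · subst hj; simp
        · simpa [Function.update_of_ne hj] using hb.pos j
      · rw [range_update_eq]
        exact hc
    have hb' := ih _ _ _ ha' hb'h (by
      intro j hj
      by_cases hji : j = i
      · subst hji; simp
      · have : N + 1 ≤ j := by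
          have : (j : ℕ) ≠ N := fun h => hji (Fin.ext h)
          omega
        simpa [Function.update_of_ne hji] using h j this)
    have := hb'.exchange (i := i) (z := b i) (e := d i) (by
      simpa using hb)
    simpa using this

lemma Hsop.good [Infinite k] {b : Fin n → MvPolynomial (Fin n) k} {d : Fin n → ℕ}
    (hb : Hsop b d) : Good b d :=
  good_of_agree n _ b d good_X hb (fun j hj => absurd j.2 (by omega))

lemma pderiv_comm' (i j : Fin n) (f : MvPolynomial (Fin n) k) :
    pderiv i (pderiv j f) = pderiv j (pderiv i f) := by
  ext m
  simp only [coeff_pderiv]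
  by_cases h : i = j
  · subst h; rfl
  · simp only [Finsupp.add_apply, Finsupp.single_apply, h, Ne.symm h, if_false, add_zero,
      add_right_comm m]
    ring

/-- The fold underlying `partialDerivPow`. -/
noncomputable def pfold (l : List (Fin n)) (α : Fin n → ℕ)
    (f : MvPolynomial (Fin n) k) : MvPolynomial (Fin n) k :=
  l.foldl (fun g i => (fun h => pderiv i h)^[α i] g) f

lemma pderiv_iter (i j : Fin n) (m : ℕ) (f : MvPolynomial (Fin n) k) :
    pderiv i ((fun h => pderiv j h)^[m] f) = (fun h => pderiv j h)^[m] (pderiv i f) := by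
  induction m generalizing f with
  | zero => rfl
  | succ m ih => rw [Function.iterate_succ_apply, Function.iterate_succ_apply, ih, pderiv_comm']

lemma pderiv_pfold (i : Fin n) (l : List (Fin n)) (α : Fin n → ℕ) (f : MvPolynomial (Fin n) k) :
    pderiv i (pfold l α f) = pfold l α (pderiv i f) := by
  induction l generalizing f with
  | nil => rfl
  | cons a l ih =>
    change pderiv i (pfold l α _) = pfold l α _
    rw [ih, pderiv_iter]

lemma pfold_congr (l : List (Fin n)) (α β : Fin n → ℕ) (h : ∀ i ∈ l, α i = β i)
    (f : MvPolynomial (Fin n) k) : pfold l α f = pfold l β f := by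
  induction l generalizing f with
  | nil => rfl
  | cons a l ih =>
    change pfold l α ((fun h => pderiv a h)^[α a] f) = pfold l β ((fun h => pderiv a h)^[β a] f)
    rw [h a (by simp), ih (fun i hi => h i (by simp [hi]))]

lemma pfold_succ (i : Fin n) (l : List (Fin n)) (hl : l.Nodup) (hi : i ∈ l) (α β : Fin n → ℕ)
    (h1 : β i = α i + 1) (h2 : ∀ j, j ≠ i → β j = α j) (f : MvPolynomial (Fin n) k) :
    pfold l β f = pderiv i (pfold l α f) := by
  induction l generalizing f with
  | nil => simp at hi
  | cons a l ih =>
    change pfold l β ((fun h => pderiv a h)^[β a] f)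
      = pderiv i (pfold l α ((fun h => pderiv a h)^[α a] f))
    rw [List.nodup_cons] at hl
    by_cases hai : a = i
    · subst hai
      rw [h1, Function.iterate_succ_apply', pderiv_pfold]
      apply pfold_congr
      intro j hj
      exact h2 j (by rintro rfl; exact hl.1 hj)
    · rw [h2 a hai]
      apply ih hl.2
      rcases List.mem_cons.1 hi with h | h
      · exact absurd h.symm hai
      · exact h

lemma partialDerivPow_succ (i : Fin n) (α : Fin n →₀ ℕ) (f : MvPolynomial (Fin n) k) :
    partialDerivPow (fun j => (α + Finsupp.single i 1 : Fin n →₀ ℕ) j) f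
      = pderiv i (partialDerivPow (fun j => α j) f) := by
  apply pfold_succ i _ (List.nodup_finRange n) (List.mem_finRange i)
  · simp
  · intro j hj
    simp [Finsupp.single_apply, Ne.symm hj]

lemma partialDerivPow_zero (f : MvPolynomial (Fin n) k) :
    partialDerivPow (fun j => (0 : Fin n →₀ ℕ) j) f = f := by
  change pfold _ _ f = f
  induction List.finRange n with
  | nil => rfl
  | cons a l ih => exact ih

lemma diffOp_eq_sum (p f : MvPolynomial (Fin n) k) {s : Finset (Fin n →₀ ℕ)}
    (hs : p.support ⊆ s) :
    diffOp p f = ∑ e ∈ s, C (p.coeff e) * partialDerivPow (fun i => e i) f := by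
  apply Finset.sum_subset hs
  intro e _ he
  rw [notMem_support_iff.1 he, C_0, zero_mul]

lemma diffOp_add (p q f : MvPolynomial (Fin n) k) :
    diffOp (p + q) f = diffOp p f + diffOp q f := by
  classical
  rw [diffOp_eq_sum (p + q) f (s := p.support ∪ q.support) support_add,
    diffOp_eq_sum p f (s := p.support ∪ q.support) Finset.subset_union_left,
    diffOp_eq_sum q f (s := p.support ∪ q.support) Finset.subset_union_right,
    ← Finset.sum_add_distrib]
  apply Finset.sum_congr rfl
  intro e _
  rw [coeff_add, C_add, add_mul]

lemma diffOp_C_mul (c : k) (q f : MvPolynomial (Fin n) k) :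
    diffOp (C c * q) f = C c * diffOp q f := by
  classical
  rw [diffOp_eq_sum (C c * q) f (s := q.support), diffOp, Finset.mul_sum]
  · apply Finset.sum_congr rfl
    intro e _
    rw [coeff_C_mul, C_mul, mul_assoc]
  · intro e he
    rw [mem_support_iff, coeff_C_mul] at he
    rw [mem_support_iff]
    exact right_ne_zero_of_mul he

lemma diffOp_X_mul (i : Fin n) (q f : MvPolynomial (Fin n) k) :
    diffOp (X i * q) f = pderiv i (diffOp q f) := by
  classical
  rw [diffOp, support_X_mul, Finset.sum_map, diffOp, map_sum]
  apply Finset.sum_congr rfl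
  intro e _
  rw [pderiv_C_mul, ← partialDerivPow_succ]
  simp only [addLeftEmbedding_apply]
  rw [coeff_X_mul, add_comm]

lemma diffOp_mul_eq_zero (q p f : MvPolynomial (Fin n) k) (h : diffOp p f = 0) :
    diffOp (q * p) f = 0 := by
  induction q using MvPolynomial.induction_on with
  | C a => rw [diffOp_C_mul, h, mul_zero]
  | add q r hq hr => rw [add_mul, diffOp_add, hq, hr, add_zero]
  | mul_X q i hq => rw [mul_comm q, mul_assoc, diffOp_X_mul, hq, map_zero]

/-- The annihilator of `f`. -/
noncomputable def annIdeal (f : MvPolynomial (Fin n) k) : Ideal (MvPolynomial (Fin n) k) where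
  carrier := {q | diffOp q f = 0}
  zero_mem' := by simp [diffOp]
  add_mem' := by
    intro a b ha hb
    change diffOp (a + b) f = 0
    rw [diffOp_add, show diffOp a f = 0 from ha, show diffOp b f = 0 from hb, add_zero]
  smul_mem' := by
    intro c x hx
    exact diffOp_mul_eq_zero c x f hx

lemma coeff_partialDerivPow_ne_zero [CharZero k] (α : Fin n →₀ ℕ) (f : MvPolynomial (Fin n) k) :
    ∀ γ : Fin n →₀ ℕ, coeff (γ + α) f ≠ 0 → coeff γ (partialDerivPow (fun j => α j) f) ≠ 0 := by
  have key : ∀ N (α : Fin n →₀ ℕ), α.degree = N → ∀ γ : Fin n →₀ ℕ, coeff (γ + α) f ≠ 0 →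
      coeff γ (partialDerivPow (fun j => α j) f) ≠ 0 := by
    intro N
    induction N with
    | zero =>
      intro α hα γ h
      obtain rfl : α = 0 := (Finsupp.degree_eq_zero_iff α).1 hα
      rwa [partialDerivPow_zero, ← add_zero γ]
    | succ N ih =>
      intro α hα γ h
      have hα0 : α ≠ 0 := by
        rintro rfl
        simp at hα
      obtain ⟨i, hi⟩ := Finsupp.ne_iff.1 hα0
      have hi' : Finsupp.single i 1 ≤ α := by
        rw [Finsupp.single_le_iff]
        exact Nat.one_le_iff_ne_zero.2 hi
      obtain ⟨β, rfl⟩ := exists_add_of_le hi'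
      rw [add_comm (Finsupp.single i 1) β] at h hα ⊢
      rw [partialDerivPow_succ, coeff_pderiv]
      refine mul_ne_zero (ih β ?_ _ ?_) ?_
      · simpa using hα
      · rwa [add_right_comm, add_assoc]
      · exact_mod_cast Nat.succ_ne_zero (γ i)
  exact key _ α rfl

end MacaulayBound

/-- If `p_1,…,p_n` are homogeneous polynomials in `n` variables over an
algebraically closed field of characteristic `0` whose common zero set is
exactly `{0}`, and `M = Σ deg p_i`, then every polynomial solution `f` of the
system `p_1(∂)f = ⋯ = p_n(∂)f = 0` has total degree at most `M - n`. -/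
theorem totalDegree_le_of_diffOp_eq_zero
    {k : Type*} [Field k] [IsAlgClosed k] [CharZero k] {n : ℕ}
    (p : Fin n → MvPolynomial (Fin n) k) (deg : Fin n → ℕ)
    (hp : ∀ i, (p i).IsHomogeneous (deg i))
    (hz : {ξ : Fin n → k | ∀ i, eval ξ (p i) = 0} = {0})
    (f : MvPolynomial (Fin n) k) (hf : ∀ i, diffOp (p i) f = 0) :
    (f.totalDegree : ℤ) ≤ ((∑ i, deg i : ℕ) : ℤ) - (n : ℤ) := by
  classical
  have hinf : Infinite k := inferInstance
  have h0 : ∀ i, eval 0 (p i) = 0 := by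
    have : (0 : Fin n → k) ∈ {ξ : Fin n → k | ∀ i, eval ξ (p i) = 0} := by rw [hz]; rfl
    exact this
  have hrad : ∀ j, X j ∈ (Ideal.span (Set.range p)).radical := by
    intro j
    rw [← vanishingIdeal_zeroLocus_eq_radical (K := k), mem_vanishingIdeal_iff]
    intro x hx
    rw [zeroLocus_span] at hx
    have hx' : x ∈ {ξ : Fin n → k | ∀ i, eval ξ (p i) = 0} := by
      intro i
      have := hx (p i) ⟨i, rfl⟩
      rw [← coe_aeval_eq_eval]
      exact this
    rw [hz] at hx'
    obtain rfl : x = 0 := hx'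
    simp
  have hsop : Hsop p (fun i => if p i = 0 then 1 else deg i) := by
    refine ⟨?_, ?_, hrad⟩
    · intro i
      split_ifs with h
      · rw [h]; exact isHomogeneous_zero _ _ _
      · exact hp i
    · intro i
      split_ifs with h
      · exact one_pos
      · by_contra hd
        have hd0 : deg i = 0 := by omega
        apply h
        have hpi := hp i
        rw [hd0, ← totalDegree_zero_iff_isHomogeneous, totalDegree_eq_zero_iff_eq_C] at hpi
        have h1 := h0 i
        rw [hpi, eval_C] at h1
        rw [hpi, h1, C_0]
  have hgood := hsop.good
  have hne : ∀ i, p i ≠ 0 := by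
    intro i hi
    have := hgood.reg ∅ i (by simp) 1 (by simp [hi])
    simp at this
  have hdeg : (fun i => if p i = 0 then 1 else deg i) = deg := by
    funext i
    rw [if_neg (hne i)]
  rw [hdeg] at hgood
  have hle : n ≤ ∑ i, deg i := by
    calc n = ∑ i : Fin n, 1 := by simp
      _ ≤ _ := Finset.sum_le_sum (fun i _ => hgood.pos i)
  by_contra hlt
  have hD : ∑ i, deg i < f.totalDegree + n := by omega
  have hf0 : f ≠ 0 := by
    rintro rfl
    rw [totalDegree_zero] at hD
    omega
  obtain ⟨α, hα, hαd⟩ := Finset.exists_mem_eq_sup f.support (support_nonempty.2 hf0)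
    (fun s => s.sum fun _ e => e)
  have hαd' : α.degree = f.totalDegree := hαd.symm
  have hmem := hgood.bound _ hD (monomial α 1) (isHomogeneous_monomial _ hαd')
  have hann : (monomial α 1 : MvPolynomial (Fin n) k) ∈ annIdeal f := by
    refine (Ideal.span_le.2 ?_) hmem
    rintro _ ⟨i, rfl⟩
    exact hf i
  have hann' : diffOp (monomial α 1) f = 0 := hann
  rw [diffOp_eq_sum _ _ (s := {α}) support_monomial_subset, Finset.sum_singleton, coeff_monomial,
    if_pos rfl, C_1, one_mul] at hann'
  refine coeff_partialDerivPow_ne_zero α f 0 ?_ ?_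
  · rw [zero_add]; exact mem_support_iff.1 hα
  · rw [hann', coeff_zero]
end
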